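/- arXiv:2106.03551 — 4 statements merged into one kernel-verified Lean document; each statement's English description precedes it below -/
import Mathlib

section
/- The double integral ∫₀^∞ ∫₀^∞ (1/(√x √y)) · exp(−(x² + 4xy + y²)/(4y)) · (log(x/y))² dx dy equals 2√(2/3) · π · (π² + (arccosh 2)²). -/
open Real MeasureTheory

section Sech

theorem hasSum_neg_one_pow_div_odd_cube :
    HasSum (fun n : ℕ => (-1 : ℝ) ^ n / (2 * n + 1) ^ 3) (π ^ 3 / 32) := by
  have h := hasSum_L_function_mod_four_eval_three
  have hinj : Function.Injective (fun n : ℕ => 2 * n + 1) := fun a b h => by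
    simpa using h
  rw [← hinj.hasSum_iff] at h
  · refine Eq.subst (motive := fun f => HasSum f _) (funext fun n => ?_) h
    have : Real.sin (π * ((2 * n + 1 : ℕ) : ℝ) / 2) = (-1) ^ n := by
      rw [← Real.cos_nat_mul_pi, ← Real.sin_add_pi_div_two]
      congr 1
      push_cast
      ring
    simp only [Function.comp_apply, this]
    push_cast
    ring
  · intro n hn
    have heven : Even n := by
      by_contra ho
      obtain ⟨k, hk⟩ := Nat.not_even_iff_odd.mp ho
      exact hn ⟨k, hk.symm⟩
    obtain ⟨k, rfl⟩ := heven
    have : π * ((k + k : ℕ) : ℝ) / 2 = k * π := by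
      push_cast
      ring
    rw [this, Real.sin_nat_mul_pi, mul_zero]

theorem integral_sq_mul_exp_neg_mul_Ioi {c : ℝ} (hc : 0 < c) :
    ∫ u in Set.Ioi (0 : ℝ), u ^ 2 * exp (-(c * u)) = 2 / c ^ 3 := by
  have h := Real.integral_rpow_mul_exp_neg_mul_Ioi (a := 3) (by norm_num) hc
  have h3 : Real.Gamma 3 = 2 := by
    rw [show (3 : ℝ) = (2 : ℕ) + 1 by norm_num, Real.Gamma_nat_eq_factorial]
    norm_num [Nat.factorial]
  rw [h3] at h
  norm_num at h
  rw [h]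
  field_simp

theorem hasSum_exp_neg_odd_mul {u : ℝ} (hu : 0 < u) :
    HasSum (fun n : ℕ => (-1 : ℝ) ^ n * exp (-((2 * n + 1) * u))) (1 / (2 * cosh u)) := by
  have hlt : exp (-(2 * u)) < 1 := by
    rw [Real.exp_lt_one_iff]
    linarith
  have h := (hasSum_geometric_of_abs_lt_one (r := -exp (-(2 * u)))
    (by rw [abs_neg, abs_of_pos (exp_pos _)]; exact hlt)).mul_left (exp (-u))
  have hval : exp (-u) * (1 - -exp (-(2 * u)))⁻¹ = 1 / (2 * cosh u) := by
    have h2 : exp (-(2 * u)) = exp (-u) * exp (-u) := by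
      rw [← Real.exp_add]
      congr 1
      ring
    rw [Real.cosh_eq, h2]
    have h3 : exp u = (exp (-u))⁻¹ := by rw [Real.exp_neg, inv_inv]
    rw [h3]
    have := exp_pos (-u)
    rw [sub_neg_eq_add]
    field_simp
  rw [hval] at h
  refine Eq.subst (motive := fun f => HasSum f _) (funext fun n => ?_) h
  rw [neg_pow, ← Real.exp_nat_mul, mul_left_comm, ← Real.exp_add]
  congr 2
  ring

theorem integral_sq_div_cosh : ∫ u : ℝ, u ^ 2 * (1 / (2 * cosh u)) = π ^ 3 / 8 := by
  have hpos : ∀ n : ℕ, (0 : ℝ) < 2 * n + 1 := fun n => by positivity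
  have hint : ∀ n : ℕ, IntegrableOn (fun u : ℝ => u ^ 2 * exp (-((2 * n + 1) * u)))
      (Set.Ioi 0) := fun n => by
    refine .of_integral_ne_zero ?_
    rw [integral_sq_mul_exp_neg_mul_Ioi (hpos n)]
    have := hpos n
    positivity
  have hsum : Summable (fun n : ℕ => 2 / (2 * (n : ℝ) + 1) ^ 3) := by
    have := hasSum_neg_one_pow_div_odd_cube.summable.abs.mul_left 2
    refine this.congr fun n => ?_
    have := hpos n
    rw [abs_div, abs_pow, abs_neg, abs_one, one_pow, abs_of_pos (by positivity)]
    ring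
  have key := hasSum_integral_of_summable_integral_norm
    (F := fun (n : ℕ) (u : ℝ) => (-1 : ℝ) ^ n * (u ^ 2 * exp (-((2 * n + 1) * u))))
    (μ := volume.restrict (Set.Ioi 0)) (fun n => (hint n).const_mul _) (by
      refine hsum.congr fun n => ?_
      rw [← integral_sq_mul_exp_neg_mul_Ioi (hpos n)]
      refine integral_congr_ae (.of_forall fun u => ?_)
      simp)
  have hval : ∫ u in Set.Ioi (0 : ℝ), u ^ 2 * (1 / (2 * cosh u)) = π ^ 3 / 16 := by
    have h2 : HasSum (fun n : ℕ => ∫ u in Set.Ioi (0 : ℝ),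
        (-1 : ℝ) ^ n * (u ^ 2 * exp (-((2 * n + 1) * u)))) (2 * (π ^ 3 / 32)) := by
      refine Eq.subst (motive := fun f => HasSum f _) (funext fun n => ?_) (hasSum_neg_one_pow_div_odd_cube.mul_left 2)
      rw [integral_const_mul, integral_sq_mul_exp_neg_mul_Ioi (hpos n)]
      ring
    have h3 := key.unique h2
    rw [show π ^ 3 / 16 = 2 * (π ^ 3 / 32) by ring, ← h3]
    refine setIntegral_congr_fun measurableSet_Ioi fun u hu => ?_
    have := ((hasSum_exp_neg_odd_mul hu).mul_left (u ^ 2)).tsum_eq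
    refine Eq.trans this.symm ?_
    refine tsum_congr fun n => ?_
    ring
  have h := integral_comp_abs (f := fun u => u ^ 2 * (1 / (2 * cosh u)))
  simp only [sq_abs, Real.cosh_abs] at h
  rw [h, hval]
  ring

theorem integral_one_div_cosh : ∫ u : ℝ, 1 / (2 * cosh u) = π / 2 := by
  have hd : ∀ u ∈ Set.Ici (0 : ℝ),
      HasDerivAt (fun u => arctan (exp u)) (1 / (2 * cosh u)) u := fun u _ => by
    convert (Real.hasDerivAt_exp u).arctan using 1
    rw [Real.cosh_eq, Real.exp_neg]
    have := exp_pos u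
    field_simp
    ring
  have hlim : Filter.Tendsto (fun u => arctan (exp u)) Filter.atTop (nhds (π / 2)) :=
    (Real.tendsto_arctan_atTop.mono_right nhdsWithin_le_nhds).comp Real.tendsto_exp_atTop
  have hval := integral_Ioi_of_hasDerivAt_of_nonneg' hd
    (fun u _ => by have := Real.cosh_pos u; positivity) hlim
  have h := integral_comp_abs (f := fun u => 1 / (2 * cosh u))
  simp only [Real.cosh_abs] at h
  rw [h, hval, Real.exp_zero, Real.arctan_one]
  ring

theorem integrable_one_div_cosh : Integrable (fun u : ℝ => 1 / (2 * cosh u)) := by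
  refine .of_integral_ne_zero ?_
  rw [integral_one_div_cosh]
  positivity

theorem integrable_sq_div_cosh : Integrable (fun u : ℝ => u ^ 2 * (1 / (2 * cosh u))) := by
  refine .of_integral_ne_zero ?_
  rw [integral_sq_div_cosh]
  positivity

theorem integrable_mul_div_cosh : Integrable (fun u : ℝ => u * (1 / (2 * cosh u))) := by
  refine (integrable_one_div_cosh.add integrable_sq_div_cosh).mono'
    (continuous_id.aestronglyMeasurable.mul integrable_one_div_cosh.aestronglyMeasurable)
    (.of_forall fun u => ?_)
  have h1 : 0 < 1 / (2 * cosh u) := by have := Real.cosh_pos u; positivity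
  have h2 : |u| ≤ 1 + u ^ 2 := by
    rw [← sq_abs]
    nlinarith [sq_nonneg (|u| - 1), abs_nonneg u]
  simp only [norm_mul, Real.norm_eq_abs, Pi.add_apply, abs_of_pos h1]
  nlinarith [mul_le_mul_of_nonneg_right h2 h1.le]

theorem integral_mul_div_cosh : ∫ u : ℝ, u * (1 / (2 * cosh u)) = 0 := by
  have h := integral_neg_eq_self (fun u : ℝ => u * (1 / (2 * cosh u))) volume
  simp only [Real.cosh_neg, neg_mul, integral_neg] at h
  linarith

theorem integrable_sq_mul_shift_div_cosh (a : ℝ) :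
    Integrable (fun v : ℝ => v ^ 2 * (1 / (2 * cosh (v - a)))) := by
  have h := ((integrable_sq_div_cosh.add (integrable_mul_div_cosh.const_mul (2 * a))).add
    (integrable_one_div_cosh.const_mul (a ^ 2))).comp_sub_right a
  refine h.congr (.of_forall fun v => ?_)
  simp only [Pi.add_apply]
  ring

theorem integral_sq_mul_shift_div_cosh (a : ℝ) :
    ∫ v : ℝ, v ^ 2 * (1 / (2 * cosh (v - a))) = π ^ 3 / 8 + a ^ 2 * (π / 2) := by
  rw [← integral_add_right_eq_self _ a]
  calc ∫ v : ℝ, (v + a) ^ 2 * (1 / (2 * cosh (v + a - a)))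
      = ∫ v : ℝ, (v ^ 2 * (1 / (2 * cosh v)) + 2 * a * (v * (1 / (2 * cosh v))))
          + a ^ 2 * (1 / (2 * cosh v)) := by
        refine integral_congr_ae (.of_forall fun v => ?_)
        simp only [add_sub_cancel_right]
        ring
    _ = π ^ 3 / 8 + a ^ 2 * (π / 2) := by
        rw [integral_add (by exact integrable_sq_div_cosh.add (integrable_mul_div_cosh.const_mul _))
          (integrable_one_div_cosh.const_mul _),
          integral_add integrable_sq_div_cosh (integrable_mul_div_cosh.const_mul _),
          integral_const_mul, integral_const_mul, integral_sq_div_cosh, integral_mul_div_cosh,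
          integral_one_div_cosh]
        ring

theorem exp_div_one_add_cosh_two_mul {a : ℝ} (ha : 0 < a) (hcosh : cosh (2 * a) = 2) (v : ℝ) :
    exp v / (1 + cosh (2 * v) / 2) = 2 / sinh (2 * a) *
      (exp a * (1 / (2 * cosh (v - a))) - exp (-a) * (1 / (2 * cosh (v - -a)))) := by
  have hs : 0 < sinh (2 * a) := Real.sinh_pos_iff.mpr (by linarith)
  have hE := exp_pos v
  have hA := exp_pos a
  have e2 : ∀ t : ℝ, exp (2 * t) = exp t ^ 2 := fun t => by
    rw [sq, ← Real.exp_add, two_mul]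
  have hrel : exp a ^ 4 + 1 = 4 * exp a ^ 2 := by
    rw [Real.cosh_eq, Real.exp_neg, e2] at hcosh
    field_simp at hcosh
    linarith
  have hsinh : sinh (2 * a) = (exp a ^ 4 - 1) / (2 * exp a ^ 2) := by
    rw [Real.sinh_eq, Real.exp_neg, e2]
    field_simp
  have hpos : 0 < exp a ^ 4 - 1 := by
    rw [hsinh] at hs
    rcases div_pos_iff.mp hs with h | h
    · exact h.1
    · nlinarith [h.2, pow_pos hA 2]
  have h1 : 1 / (2 * cosh (v - a)) = exp v * exp a / (exp v ^ 2 + exp a ^ 2) := by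
    rw [Real.cosh_eq, Real.exp_neg, Real.exp_sub]
    field_simp
  have h2 : 1 / (2 * cosh (v - -a)) = exp v * exp a / (exp v ^ 2 * exp a ^ 2 + 1) := by
    rw [Real.cosh_eq, Real.exp_neg, sub_neg_eq_add, Real.exp_add]
    field_simp
  have h3 : exp v / (1 + cosh (2 * v) / 2) = 4 * exp v ^ 3 / (exp v ^ 4 + 4 * exp v ^ 2 + 1) := by
    rw [Real.cosh_eq, Real.exp_neg, e2]
    field_simp
    ring
  rw [h1, h2, h3, hsinh, Real.exp_neg]
  generalize exp v = E at *
  generalize exp a = A at *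
  have hfac : (E ^ 2 + A ^ 2) * (E ^ 2 * A ^ 2 + 1) = A ^ 2 * (E ^ 4 + 4 * E ^ 2 + 1) := by
    linear_combination E ^ 2 * hrel
  have hD : A ^ 2 * (E ^ 4 + 4 * E ^ 2 + 1) ≠ 0 := by positivity
  have hsub : A * (E * A / (E ^ 2 + A ^ 2)) - A⁻¹ * (E * A / (E ^ 2 * A ^ 2 + 1))
      = E ^ 3 * (A ^ 4 - 1) / (A ^ 2 * (E ^ 4 + 4 * E ^ 2 + 1)) := by
    rw [← hfac]
    field_simp
    ring
  rw [hsub]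
  field_simp
  ring

theorem integral_sq_mul_exp_div_one_add_cosh :
    ∫ v : ℝ, 8 * v ^ 2 * (exp v / (1 + cosh (2 * v) / 2))
      = 2 * √(2 / 3) * π * (π ^ 2 + log (2 + √3) ^ 2) := by
  have h3 : √3 ^ 2 = 3 := Real.sq_sqrt (by norm_num)
  have h3pos : 0 < √3 := by positivity
  obtain ⟨a, hlog⟩ : ∃ a, log (2 + √3) = 2 * a := ⟨log (2 + √3) / 2, by ring⟩
  have hexp : exp (2 * a) = 2 + √3 := by rw [← hlog, Real.exp_log (by positivity)]
  have hexpn : exp (-(2 * a)) = 2 - √3 := by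
    rw [Real.exp_neg, hexp]
    refine inv_eq_of_mul_eq_one_left ?_
    linear_combination -h3
  have ha : 0 < a := by
    have : 0 < log (2 + √3) := Real.log_pos (by linarith)
    linarith
  have hcosh : cosh (2 * a) = 2 := by rw [Real.cosh_eq, hexp, hexpn]; ring
  have hsinh : 0 < sinh a := Real.sinh_pos_iff.mpr ha
  have hcoshv : cosh a = √(2 / 3) * (3 / 2) := by
    have hc := Real.cosh_pos a
    have h1 : cosh a ^ 2 = 3 / 2 := by
      have := Real.cosh_two_mul a
      have := Real.cosh_sq a
      linarith
    have h2 : √(2 / 3) ^ 2 = 2 / 3 := Real.sq_sqrt (by norm_num)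
    rw [← sq_eq_sq₀ hc.le (by positivity), h1, mul_pow, h2]
    norm_num
  calc ∫ v : ℝ, 8 * v ^ 2 * (exp v / (1 + cosh (2 * v) / 2))
      = ∫ v : ℝ, 16 / sinh (2 * a) * (exp a * (v ^ 2 * (1 / (2 * cosh (v - a))))
          - exp (-a) * (v ^ 2 * (1 / (2 * cosh (v - -a))))) := by
        refine integral_congr_ae (.of_forall fun v => ?_)
        simp only [exp_div_one_add_cosh_two_mul ha hcosh v]
        ring
    _ = 16 / sinh (2 * a) * ((exp a - exp (-a)) * (π ^ 3 / 8 + a ^ 2 * (π / 2))) := by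
        rw [integral_const_mul, integral_sub
          ((integrable_sq_mul_shift_div_cosh a).const_mul _)
          ((integrable_sq_mul_shift_div_cosh (-a)).const_mul _),
          integral_const_mul, integral_const_mul, integral_sq_mul_shift_div_cosh,
          integral_sq_mul_shift_div_cosh]
        ring
    _ = 2 * √(2 / 3) * π * (π ^ 2 + log (2 + √3) ^ 2) := by
        have h2 : √(2 / 3) ^ 2 = 2 / 3 := Real.sq_sqrt (by norm_num)
        have h2pos : 0 < √(2 / 3) := by positivity
        have he : exp a - exp (-a) = 2 * sinh a := by rw [Real.sinh_eq]; ring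
        rw [he, Real.sinh_two_mul, hcoshv, hlog]
        field_simp
        rw [h2]
        ring

end Sech

section DoubleIntegral

theorem setIntegral_Ioi_eq_integral_exp_two_mul {x : ℝ} (hx : 0 < x) (g : ℝ → ℝ) :
    ∫ y in Set.Ioi (0 : ℝ), g y = ∫ v : ℝ, 2 * x * exp (2 * v) * g (x * exp (2 * v)) := by
  have himg : (fun v : ℝ => x * exp (2 * v)) '' Set.univ = Set.Ioi 0 := by
    ext y
    simp only [Set.image_univ, Set.mem_range, Set.mem_Ioi]
    constructor
    · rintro ⟨v, rfl⟩
      positivity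
    · intro hy
      refine ⟨log (y / x) / 2, ?_⟩
      rw [mul_div_cancel₀ _ two_ne_zero, Real.exp_log (by positivity)]
      field_simp
  have hd : ∀ v ∈ Set.univ, HasDerivWithinAt (fun v : ℝ => x * exp (2 * v))
      (2 * x * exp (2 * v)) Set.univ v := fun v _ => by
    have := (((hasDerivAt_id v).const_mul 2).exp.const_mul x).hasDerivWithinAt (s := Set.univ)
    refine this.congr_deriv ?_
    simp only [id]
    ring
  have hinj : Set.InjOn (fun v : ℝ => x * exp (2 * v)) Set.univ := fun v _ w _ h => by
    have := Real.exp_injective (mul_left_cancel₀ hx.ne' h)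
    linarith
  rw [← himg, integral_image_eq_integral_abs_deriv_smul MeasurableSet.univ hd hinj,
    setIntegral_univ]
  refine integral_congr_ae (.of_forall fun v => ?_)
  simp only [smul_eq_mul]
  rw [abs_of_pos (by positivity)]

theorem integrand_comp_exp_two_mul {x : ℝ} (hx : 0 < x) (v : ℝ) :
    2 * x * exp (2 * v) * ((1 / (√x * √(x * exp (2 * v)))) *
      exp (-(x ^ 2 + 4 * x * (x * exp (2 * v)) + (x * exp (2 * v)) ^ 2) /
        (4 * (x * exp (2 * v)))) * log (x / (x * exp (2 * v))) ^ 2)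
    = 8 * v ^ 2 * exp v * exp (-(1 + cosh (2 * v) / 2) * x) := by
  have e2 : exp (2 * v) = exp v ^ 2 := by rw [sq, ← Real.exp_add, two_mul]
  have hE := exp_pos v
  have hlog : log (x / (x * exp (2 * v))) = -(2 * v) := by
    rw [← Real.log_exp (-(2 * v)), Real.exp_neg]
    congr 1
    field_simp
  have hsqrt : √x * √(x * exp (2 * v)) = x * exp v := by
    rw [← Real.sqrt_mul hx.le, e2, show x * (x * exp v ^ 2) = (x * exp v) ^ 2 by ring,
      Real.sqrt_sq (by positivity)]
  have harg : -(x ^ 2 + 4 * x * (x * exp (2 * v)) + (x * exp (2 * v)) ^ 2) /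
      (4 * (x * exp (2 * v))) = -(1 + cosh (2 * v) / 2) * x := by
    rw [Real.cosh_eq, Real.exp_neg]
    have := exp_pos (2 * v)
    field_simp
    ring
  rw [hlog, hsqrt, harg, e2]
  field_simp
  ring

theorem integral_integral_exp_neg_one_add_cosh_mul :
    ∫ x in Set.Ioi (0 : ℝ), ∫ v : ℝ, 8 * v ^ 2 * exp v * exp (-(1 + cosh (2 * v) / 2) * x)
      = ∫ v : ℝ, 8 * v ^ 2 * (exp v / (1 + cosh (2 * v) / 2)) := by
  have hc : ∀ v : ℝ, -(1 + cosh (2 * v) / 2) < 0 := fun v => by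
    have := Real.cosh_pos (2 * v)
    linarith
  have hinner : ∀ v : ℝ,
      ∫ x in Set.Ioi (0 : ℝ), 8 * v ^ 2 * exp v * exp (-(1 + cosh (2 * v) / 2) * x)
        = 8 * v ^ 2 * (exp v / (1 + cosh (2 * v) / 2)) := fun v => by
    rw [integral_const_mul, integral_exp_mul_Ioi (hc v), mul_zero, Real.exp_zero, neg_div_neg_eq]
    ring
  rw [integral_integral_swap]
  · exact integral_congr_ae (.of_forall hinner)
  · have hmeas : AEStronglyMeasurable (Function.uncurry fun x v : ℝ =>
        8 * v ^ 2 * exp v * exp (-(1 + cosh (2 * v) / 2) * x))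
        ((volume.restrict (Set.Ioi 0)).prod volume) := by
      refine Continuous.aestronglyMeasurable ?_
      unfold Function.uncurry
      fun_prop
    rw [integrable_prod_iff' hmeas]
    refine ⟨.of_forall fun v => ?_, ?_⟩
    · exact (integrableOn_exp_mul_Ioi (hc v) 0).const_mul (8 * v ^ 2 * exp v)
    · have heq : (fun v : ℝ => ∫ x in Set.Ioi (0 : ℝ), ‖Function.uncurry (fun x v : ℝ =>
          8 * v ^ 2 * exp v * exp (-(1 + cosh (2 * v) / 2) * x)) (x, v)‖)
          = fun v : ℝ => 8 * v ^ 2 * (exp v / (1 + cosh (2 * v) / 2)) := by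
        funext v
        rw [← hinner v]
        refine integral_congr_ae (.of_forall fun x => ?_)
        exact Real.norm_of_nonneg (by simp only [Function.uncurry_apply_pair]; positivity)
      rw [heq]
      refine .of_integral_ne_zero ?_
      rw [integral_sq_mul_exp_div_one_add_cosh]
      positivity

end DoubleIntegral

theorem stmt1 :
    (∫ x in Set.Ioi (0:ℝ), ∫ y in Set.Ioi (0:ℝ),
      (1 / (Real.sqrt x * Real.sqrt y)) *
        Real.exp (-(x^2 + 4*x*y + y^2) / (4*y)) * (Real.log (x/y))^2)
    = 2 * Real.sqrt (2/3) * π * (π^2 + (Real.log (2 + Real.sqrt 3))^2) := by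
  rw [← integral_sq_mul_exp_div_one_add_cosh, ← integral_integral_exp_neg_one_add_cosh_mul]
  refine setIntegral_congr_fun measurableSet_Ioi fun x hx => ?_
  rw [setIntegral_Ioi_eq_integral_exp_two_mul hx]
  exact integral_congr_ae (.of_forall fun v => integrand_comp_exp_two_mul hx v)
end

section
/- The double integral ∫₀^∞ ∫₀^∞ exp(−(x² + xy + y²)/(4y)) · (y^{1/4} − x^{1/4}) / (x^{3/4} · √y · log(x/y)) dx dy equals 4 log(4 − 2√3). -/
open Real MeasureTheory

open Filter Topology in
theorem tendsto_sum_one_div_sub_one_div_cot {z : ℝ} (h0 : 0 < z) (h1 : z < 1) :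
    Tendsto (fun N : ℕ => ∑ n ∈ Finset.range N, (1 / (n + z) - 1 / (n + 1 - z))) atTop
      (𝓝 (π * Real.cot (π * z))) := by
  have hz : (z : ℂ) ∈ Complex.integerComplement := by
    rintro ⟨m, hm⟩
    have hm' : (m : ℝ) = z := by exact_mod_cast hm
    rw [← hm'] at h0 h1
    have h0' : 0 < m := by exact_mod_cast h0
    have h1' : m < 1 := by exact_mod_cast h1
    omega
  have hC := tendsto_logDeriv_euler_cot_sub hz
  have hR : Tendsto (fun N : ℕ => ∑ n ∈ Finset.range N, (1 / (z - (n + 1)) + 1 / (z + (n + 1))))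
      atTop (𝓝 (π * Real.cot (π * z) - 1 / z)) := by
    have := (Complex.continuous_re.tendsto _).comp hC
    convert! this using 1
    · ext N
      simp only [Function.comp_apply, cotTerm]
      rw [← Complex.ofReal_re (∑ n ∈ Finset.range N, (1 / (z - (n + 1)) + 1 / (z + (n + 1))))]
      push_cast
      rfl
    · rw [← Complex.ofReal_re (π * Real.cot (π * z) - 1 / z)]
      push_cast
      rfl
  have key : ∀ N : ℕ, ∑ n ∈ Finset.range N, (1 / (n + z) - 1 / (n + 1 - z)) =
      ∑ n ∈ Finset.range N, (1 / (z - (n + 1)) + 1 / (z + (n + 1))) + (1 / z - 1 / (N + z)) := by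
    intro N
    induction N with
    | zero => simp
    | succ N ih =>
      rw [Finset.sum_range_succ, Finset.sum_range_succ, ih]
      have : (1 : ℝ) / (z - (N + 1)) = - (1 / (N + 1 - z)) := by
        rw [← neg_sub, one_div, one_div, inv_neg]
      rw [this]
      push_cast
      ring
  simp_rw [key]
  have ht : Tendsto (fun N : ℕ => 1 / ((N : ℝ) + z)) atTop (𝓝 0) := by
    simp_rw [one_div]
    exact tendsto_inv_atTop_zero.comp
      (tendsto_atTop_add_const_right _ _ tendsto_natCast_atTop_atTop)
  have := hR.add (ht.const_sub (1 / z))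
  convert! this using 2
  ring

theorem integrableOn_rpow_div_Ioo {b : ℝ} (hb : -1 < b) :
    IntegrableOn (fun u : ℝ => u ^ b / (1 + u + u ^ 2)) (Set.Ioo 0 1) := by
  have h : IntegrableOn (fun u : ℝ => u ^ b) (Set.Ioo 0 1) :=
    (intervalIntegrable_iff_integrableOn_Ioo_of_le zero_le_one).1
      (intervalIntegral.intervalIntegrable_rpow' hb)
  refine h.mono' (Measurable.aestronglyMeasurable (by fun_prop)) ?_
  filter_upwards [ae_restrict_mem measurableSet_Ioo] with u hu
  have h0 := hu.1
  have := rpow_nonneg h0.le b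
  rw [norm_of_nonneg (by positivity)]
  exact div_le_self this (by nlinarith)

theorem integral_rpow_sub_rpow_Ioo {c : ℝ} (hc : -1 < c) :
    IntegrableOn (fun u : ℝ => u ^ c - u ^ (c + 1)) (Set.Ioo 0 1) ∧
    ∫ u in Set.Ioo (0 : ℝ) 1, (u ^ c - u ^ (c + 1)) = 1 / (c + 1) - 1 / (c + 2) := by
  have i1 := intervalIntegral.intervalIntegrable_rpow' hc (a := 0) (b := 1)
  have i2 := intervalIntegral.intervalIntegrable_rpow' (show -1 < c + 1 by linarith) (a := 0) (b := 1)
  refine ⟨(intervalIntegrable_iff_integrableOn_Ioo_of_le zero_le_one).1 (i1.sub i2), ?_⟩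
  rw [← integral_Ioc_eq_integral_Ioo, ← intervalIntegral.integral_of_le zero_le_one,
    intervalIntegral.integral_sub i1 i2, integral_rpow (.inl hc), integral_rpow (.inl (by linarith)),
    zero_rpow (by linarith), zero_rpow (by linarith), one_rpow, one_rpow]
  ring

theorem integral_rpow_add_rpow_neg_div_Ioo {b : ℝ} (h0 : 0 < b) (h1 : b < 1) :
    ∫ u in Set.Ioo (0 : ℝ) 1, (u ^ b / (1 + u + u ^ 2) + u ^ (-b) / (1 + u + u ^ 2)) =
      π / 3 * (Real.cot (π * ((1 + b) / 3)) - Real.cot (π * ((2 + b) / 3))) := by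
  set h : ℕ → ℝ → ℝ := fun n u => (u ^ (3 * n + b) - u ^ (3 * n + b + 1)) +
    (u ^ (3 * n - b) - u ^ (3 * n - b + 1)) with hh
  have p1 (n : ℕ) := integral_rpow_sub_rpow_Ioo (c := 3 * n + b) (by linarith [n.cast_nonneg (α := ℝ)])
  have p2 (n : ℕ) := integral_rpow_sub_rpow_Ioo (c := 3 * n - b) (by linarith [n.cast_nonneg (α := ℝ)])
  have hfi (n : ℕ) : IntegrableOn (h n) (Set.Ioo 0 1) := (p1 n).1.add (p2 n).1
  have hnn (n : ℕ) {u : ℝ} (hu : u ∈ Set.Ioo 0 1) : 0 ≤ h n u :=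
    add_nonneg (sub_nonneg.2 (rpow_le_rpow_of_exponent_ge hu.1 hu.2.le (by linarith)))
      (sub_nonneg.2 (rpow_le_rpow_of_exponent_ge hu.1 hu.2.le (by linarith)))
  have hval (n : ℕ) : ∫ u in Set.Ioo (0 : ℝ) 1, h n u =
      1 / 3 * (1 / (n + (1 + b) / 3) - 1 / (n + 1 - (1 + b) / 3)) -
      1 / 3 * (1 / (n + (2 + b) / 3) - 1 / (n + 1 - (2 + b) / 3)) := by
    have hn := n.cast_nonneg (α := ℝ)
    simp only [hh]
    rw [integral_add (p1 n).1 (p2 n).1, (p1 n).2, (p2 n).2]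
    have e (x y : ℝ) (hxy : 3 * x = y) : 1 / 3 * (1 / x) = 1 / y := by
      rw [← hxy]; simp only [one_div, mul_inv]
    rw [mul_sub, mul_sub, e _ (3 * n + b + 1) (by ring), e _ (3 * n - b + 2) (by ring),
      e _ (3 * n + b + 2) (by ring), e _ (3 * n - b + 1) (by ring)]
    ring
  have hS : HasSum (fun n => ∫ u in Set.Ioo (0 : ℝ) 1, h n u)
      (π / 3 * (Real.cot (π * ((1 + b) / 3)) - Real.cot (π * ((2 + b) / 3)))) := by
    rw [hasSum_iff_tendsto_nat_of_nonneg
      (fun n => setIntegral_nonneg measurableSet_Ioo (fun u hu => hnn n hu))]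
    simp_rw [hval]
    have t1 := tendsto_sum_one_div_sub_one_div_cot (z := (1 + b) / 3) (by linarith) (by linarith)
    have t2 := tendsto_sum_one_div_sub_one_div_cot (z := (2 + b) / 3) (by linarith) (by linarith)
    convert! (t1.const_mul (1 / 3)).sub (t2.const_mul (1 / 3)) using 2
    · rw [Finset.sum_sub_distrib, Finset.mul_sum, Finset.mul_sum]
    · ring
  have hnorm (n : ℕ) : ∫ u in Set.Ioo (0 : ℝ) 1, ‖h n u‖ = ∫ u in Set.Ioo (0 : ℝ) 1, h n u :=
    setIntegral_congr_fun measurableSet_Ioo fun u hu => norm_of_nonneg (hnn n hu)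
  have hT := hasSum_integral_of_summable_integral_norm hfi ((summable_congr hnorm).2 hS.summable)
  rw [← hT.unique hS]
  refine setIntegral_congr_fun measurableSet_Ioo fun u hu => ?_
  have hu0 := hu.1
  have hu1 := hu.2
  have hg := (hasSum_geometric_of_lt_one (r := u ^ 3) (by positivity)
    (pow_lt_one₀ hu0.le hu1 (by norm_num))).mul_left ((u ^ b + u ^ (-b)) * (1 - u))
  have he : (fun n : ℕ => (u ^ b + u ^ (-b)) * (1 - u) * (u ^ 3) ^ n) = fun n => h n u := by
    ext n
    have hp : u ^ (3 * n : ℝ) = (u ^ 3) ^ n := by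
      rw [← pow_mul, ← rpow_natCast]; push_cast; rfl
    simp only [hh]
    rw [rpow_add_one hu0.ne', rpow_add_one hu0.ne', sub_eq_add_neg (3 * (n : ℝ)) b,
      rpow_add hu0, rpow_add hu0, hp]
    ring
  rw [he] at hg
  rw [hg.tsum_eq]
  have : (1 : ℝ) - u ^ 3 ≠ 0 := (sub_pos.2 (pow_lt_one₀ hu0.le hu1 (by norm_num))).ne'
  have : (1 : ℝ) + u + u ^ 2 ≠ 0 := by positivity
  field_simp
  ring

theorem integral_rpow_div_Ioi {b : ℝ} (h0 : 0 < b) (h1 : b < 1) :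
    IntegrableOn (fun u : ℝ => u ^ b / (1 + u + u ^ 2)) (Set.Ioi 0) ∧
    ∫ u in Set.Ioi (0 : ℝ), u ^ b / (1 + u + u ^ 2) =
      π / 3 * (Real.cot (π * ((1 + b) / 3)) - Real.cot (π * ((2 + b) / 3))) := by
  have i1 := integrableOn_rpow_div_Ioo (b := b) (by linarith)
  have i2 := integrableOn_rpow_div_Ioo (b := -b) (by linarith)
  have himg : (fun u : ℝ => u⁻¹) '' Set.Ioo 0 1 = Set.Ioi 1 := by
    ext x
    constructor
    · rintro ⟨u, hu, rfl⟩
      exact (one_lt_inv₀ hu.1).2 hu.2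
    · intro hx
      have hx' : (1 : ℝ) < x := hx
      exact ⟨x⁻¹, ⟨by positivity, inv_lt_one_of_one_lt₀ hx'⟩, inv_inv x⟩
  have hd : ∀ u ∈ Set.Ioo (0 : ℝ) 1,
      HasDerivWithinAt (fun u : ℝ => u⁻¹) (-(u ^ 2)⁻¹) (Set.Ioo 0 1) u :=
    fun u hu => (hasDerivAt_inv hu.1.ne').hasDerivWithinAt
  have hinj : Set.InjOn (fun u : ℝ => u⁻¹) (Set.Ioo 0 1) := inv_injective.injOn
  have hcongr : Set.EqOn (fun u : ℝ => |-(u ^ 2)⁻¹| • (u⁻¹ ^ b / (1 + u⁻¹ + u⁻¹ ^ 2)))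
      (fun u => u ^ (-b) / (1 + u + u ^ 2)) (Set.Ioo 0 1) := by
    intro u hu
    have hu0 := hu.1
    simp only [abs_neg, smul_eq_mul]
    rw [abs_of_pos (by positivity), inv_rpow hu0.le, rpow_neg hu0.le]
    field_simp
    ring
  have i3 : IntegrableOn (fun u : ℝ => u ^ b / (1 + u + u ^ 2)) (Set.Ioi 1) := by
    rw [← himg, integrableOn_image_iff_integrableOn_abs_deriv_smul measurableSet_Ioo hd hinj,
      integrableOn_congr_fun hcongr measurableSet_Ioo]
    exact i2
  have e3 : ∫ u in Set.Ioi (1 : ℝ), u ^ b / (1 + u + u ^ 2) =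
      ∫ u in Set.Ioo (0 : ℝ) 1, u ^ (-b) / (1 + u + u ^ 2) := by
    rw [← himg, integral_image_eq_integral_abs_deriv_smul measurableSet_Ioo hd hinj]
    exact setIntegral_congr_fun measurableSet_Ioo hcongr
  have i1' := (integrableOn_Ioc_iff_integrableOn_Ioo (by simp)).2 i1
  rw [← Set.Ioc_union_Ioi_eq_Ioi (zero_le_one' ℝ)]
  refine ⟨i1'.union i3, ?_⟩
  rw [setIntegral_union (Set.Ioc_disjoint_Ioi le_rfl) measurableSet_Ioi i1' i3, e3,
    integral_Ioc_eq_integral_Ioo, ← integral_add i1 i2, integral_rpow_add_rpow_neg_div_Ioo h0 h1]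

theorem hasDerivAt_log_sin_pi_mul {a b : ℝ} (h0 : 0 < (a + b) / 3) (h1 : (a + b) / 3 < 1) :
    HasDerivAt (fun b => Real.log (Real.sin (π * ((a + b) / 3))))
      (π / 3 * Real.cot (π * ((a + b) / 3))) b := by
  have hs : 0 < Real.sin (π * ((a + b) / 3)) :=
    sin_pos_of_pos_of_lt_pi (by positivity) (by nlinarith [pi_pos])
  have hl : HasDerivAt (fun b : ℝ => π * ((a + b) / 3)) (π * (1 / 3)) b :=
    (((hasDerivAt_id b).const_add a).div_const 3).const_mul π
  convert! hl.sin.log hs.ne' using 1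
  rw [Real.cot_eq_cos_div_sin]
  ring

theorem continuousOn_cot_sub_cot :
    ContinuousOn (fun b : ℝ => π / 3 *
      (Real.cot (π * ((1 + b) / 3)) - Real.cot (π * ((2 + b) / 3)))) (Set.Icc (1 / 2) (3 / 4)) := by
  have hs {a b : ℝ} (h0 : 0 < (a + b) / 3) (h1 : (a + b) / 3 < 1) :
      Real.sin (π * ((a + b) / 3)) ≠ 0 :=
    (sin_pos_of_pos_of_lt_pi (by positivity) (by nlinarith [pi_pos])).ne'
  simp_rw [Real.cot_eq_cos_div_sin]
  refine continuousOn_const.mul (ContinuousOn.sub ?_ ?_) <;>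
  · refine ContinuousOn.div (by fun_prop) (by fun_prop) fun b hb => ?_
    have := hb.1
    have := hb.2
    exact hs (by linarith) (by linarith)

theorem sin_pi_div_three_add_pi_div_four_mul :
    Real.sin (π / 3 + π / 4) * (1 / 2) * (4 - 2 * √3) = Real.sin (π / 3 - π / 4) := by
  rw [Real.sin_add, Real.sin_sub, sin_pi_div_three, cos_pi_div_three, sin_pi_div_four,
    cos_pi_div_four]
  have h : √3 ^ 2 = 3 := sq_sqrt (by norm_num)
  linear_combination (-√2 / 4) * h

theorem integral_cot_sub_cot :
    ∫ b in (1 / 2 : ℝ)..(3 / 4), π / 3 *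
      (Real.cot (π * ((1 + b) / 3)) - Real.cot (π * ((2 + b) / 3))) =
      - Real.log (4 - 2 * √3) := by
  have hle : (1 / 2 : ℝ) ≤ 3 / 4 := by norm_num
  rw [intervalIntegral.integral_eq_sub_of_hasDerivAt (f := fun b =>
    Real.log (Real.sin (π * ((1 + b) / 3))) - Real.log (Real.sin (π * ((2 + b) / 3))))]
  · have s1 : π * ((1 + 3 / 4) / 3) = π / 3 + π / 4 := by ring
    have s2 : π * ((2 + 3 / 4) / 3) = π - (π / 3 - π / 4) := by ring
    have s3 : π * ((1 + 1 / 2) / 3) = π / 2 := by ring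
    have s4 : π * ((2 + 1 / 2) / 3) = π - π / 6 := by ring
    rw [s1, s2, s3, s4, sin_pi_sub, sin_pi_sub, sin_pi_div_two, sin_pi_div_six, log_one,
      ← sin_pi_div_three_add_pi_div_four_mul]
    have hs : 0 < Real.sin (π / 3 + π / 4) :=
      sin_pos_of_pos_of_lt_pi (by positivity) (by linarith [pi_pos])
    have h3 : √3 < 2 := by rw [sqrt_lt' (by norm_num)]; norm_num
    rw [log_mul (by positivity) (by linarith), log_mul hs.ne' (by norm_num)]
    ring
  · intro b hb
    rw [Set.uIcc_of_le hle] at hb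
    have := hb.1
    have := hb.2
    rw [mul_sub]
    exact (hasDerivAt_log_sin_pi_mul (by linarith) (by linarith)).sub
      (hasDerivAt_log_sin_pi_mul (by linarith) (by linarith))
  · refine ContinuousOn.intervalIntegrable ?_
    rw [Set.uIcc_of_le hle]
    exact continuousOn_cot_sub_cot

theorem integral_const_rpow {u : ℝ} (hu : 0 < u) (hu1 : u ≠ 1) (a b : ℝ) :
    ∫ s in a..b, u ^ s = (u ^ b - u ^ a) / Real.log u := by
  have hl : Real.log u ≠ 0 := log_ne_zero_of_pos_of_ne_one hu hu1
  rw [intervalIntegral.integral_eq_sub_of_hasDerivAt (f := fun s => u ^ s / Real.log u)]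
  · ring
  · intro s _
    convert! ((hasStrictDerivAt_const_rpow hu s).hasDerivAt.div_const (Real.log u)) using 1
    field_simp
  · exact (continuous_const.rpow continuous_id fun _ => .inl hu.ne').intervalIntegrable _ _

theorem integral_rpow_sub_rpow_div_log_Ioi :
    IntegrableOn (fun u : ℝ => (u ^ (3 / 4 : ℝ) - u ^ (1 / 2 : ℝ)) / Real.log u / (1 + u + u ^ 2))
      (Set.Ioi 0) ∧
    ∫ u in Set.Ioi (0 : ℝ), (u ^ (3 / 4 : ℝ) - u ^ (1 / 2 : ℝ)) / Real.log u / (1 + u + u ^ 2) =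
      - Real.log (4 - 2 * √3) := by
  have hle : (1 / 2 : ℝ) ≤ 3 / 4 := by norm_num
  set μ := (volume : Measure ℝ).restrict (Set.Ioc (1 / 2) (3 / 4)) with hμ
  set ν := (volume : Measure ℝ).restrict (Set.Ioi 0) with hν
  have hb : ∀ᵐ b ∂μ, 0 < b ∧ b < 1 := by
    filter_upwards [ae_restrict_mem measurableSet_Ioc] with b hb
    exact ⟨by linarith [hb.1], by linarith [hb.2]⟩
  have hfi : Integrable (Function.uncurry fun b u : ℝ => u ^ b / (1 + u + u ^ 2)) (μ.prod ν) := by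
    rw [integrable_prod_iff (Measurable.aestronglyMeasurable (by fun_prop))]
    refine ⟨?_, ?_⟩
    · filter_upwards [hb] with b hb using (integral_rpow_div_Ioi hb.1 hb.2).1
    · have hK : Integrable (fun b : ℝ => π / 3 *
          (Real.cot (π * ((1 + b) / 3)) - Real.cot (π * ((2 + b) / 3)))) μ :=
        (continuousOn_cot_sub_cot.integrableOn_Icc).mono_set Set.Ioc_subset_Icc_self
      refine hK.congr ?_
      filter_upwards [hb] with b hb
      rw [← (integral_rpow_div_Ioi hb.1 hb.2).2]
      refine setIntegral_congr_fun measurableSet_Ioi fun u hu => ?_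
      have hu0 : 0 < u := hu
      exact (norm_of_nonneg (show 0 ≤ u ^ b / (1 + u + u ^ 2) by positivity)).symm
  have hae : (fun u : ℝ => ∫ b, u ^ b / (1 + u + u ^ 2) ∂μ) =ᵐ[ν]
      fun u => (u ^ (3 / 4 : ℝ) - u ^ (1 / 2 : ℝ)) / Real.log u / (1 + u + u ^ 2) := by
    have h1 : ∀ᵐ u ∂ν, u ≠ 1 := ae_restrict_of_ae (Measure.ae_ne volume 1)
    filter_upwards [ae_restrict_mem measurableSet_Ioi, h1] with u hu hu1
    rw [integral_div, hμ, ← intervalIntegral.integral_of_le hle, integral_const_rpow hu hu1]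
  refine ⟨hfi.integral_prod_right.congr hae, ?_⟩
  rw [← integral_congr_ae hae, ← integral_integral_swap hfi, ← integral_cot_sub_cot,
    intervalIntegral.integral_of_le hle]
  refine integral_congr_ae ?_
  filter_upwards [hb] with b hb using (integral_rpow_div_Ioi hb.1 hb.2).2

theorem rpow_sub_one_div_log_nonneg {u a : ℝ} (hu : 0 < u) (ha : 0 ≤ a) :
    0 ≤ (u ^ a - 1) / Real.log u := by
  rcases le_total 1 u with h | h
  · exact div_nonneg (sub_nonneg.2 (one_le_rpow h ha)) (log_nonneg h)
  · exact div_nonneg_of_nonpos (sub_nonpos.2 (rpow_le_one hu.le h ha)) (log_nonpos hu.le h)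

theorem stmt2 :
    (∫ x in Set.Ioi (0:ℝ), ∫ y in Set.Ioi (0:ℝ),
      Real.exp (-(x^2 + x*y + y^2) / (4*y)) *
        (y ^ ((1:ℝ)/4) - x ^ ((1:ℝ)/4)) /
        (x ^ ((3:ℝ)/4) * Real.sqrt y * Real.log (x/y)))
    = 4 * Real.log (4 - 2 * Real.sqrt 3) := by
  set c : ℝ → ℝ := fun u => (1 + u + u ^ 2) / (4 * u) with hc
  set g : ℝ → ℝ := fun u => (u ^ (1 / 4 : ℝ) - 1) / Real.log u / √u with hg
  have hg0 {u : ℝ} (hu : 0 < u) : 0 ≤ g u :=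
    div_nonneg (rpow_sub_one_div_log_nonneg hu (by norm_num)) (sqrt_nonneg u)
  have hc0 {u : ℝ} (hu : 0 < u) : 0 < c u := by positivity
  have hinner : ∀ x ∈ Set.Ioi (0 : ℝ), (∫ y in Set.Ioi (0:ℝ),
      Real.exp (-(x^2 + x*y + y^2) / (4*y)) *
        (y ^ ((1:ℝ)/4) - x ^ ((1:ℝ)/4)) /
        (x ^ ((3:ℝ)/4) * Real.sqrt y * Real.log (x/y))) =
      ∫ u in Set.Ioi (0 : ℝ), -(g u * Real.exp (-c u * x)) := by
    intro x hx
    have hx0 : 0 < x := hx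
    have := integral_comp_mul_left_Ioi' (fun y : ℝ => Real.exp (-(x^2 + x*y + y^2) / (4*y)) *
        (y ^ ((1:ℝ)/4) - x ^ ((1:ℝ)/4)) /
        (x ^ ((3:ℝ)/4) * Real.sqrt y * Real.log (x/y))) 0 hx0
    rw [mul_zero] at this
    rw [← this, smul_eq_mul, ← integral_const_mul]
    refine setIntegral_congr_fun measurableSet_Ioi fun u hu => ?_
    have hu0 : 0 < u := hu
    have e1 : -(x ^ 2 + x * (x * u) + (x * u) ^ 2) / (4 * (x * u)) = -c u * x := by
      simp only [hc]
      field_simp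
    have e2 : x / (x * u) = u⁻¹ := by field_simp
    have e3 : x = x ^ (3 / 4 : ℝ) * x ^ (1 / 4 : ℝ) := by
      rw [← rpow_add hx0]; norm_num
    have e4 : √x = x ^ (1 / 4 : ℝ) * x ^ (1 / 4 : ℝ) := by
      rw [← rpow_add hx0, sqrt_eq_rpow]; norm_num
    simp only [hg]
    rw [e1, e2, mul_rpow hx0.le hu0.le, sqrt_mul hx0.le, log_inv]
    generalize Real.exp (-c u * x) = E
    rw [e4]
    nth_rewrite 1 [e3]
    have : 0 < x ^ (3 / 4 : ℝ) := by positivity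
    have : 0 < x ^ (1 / 4 : ℝ) := by positivity
    have : 0 < √u := by positivity
    by_cases hl : Real.log u = 0
    · simp [hl]
    · field_simp
  rw [setIntegral_congr_fun measurableSet_Ioi hinner]
  have hH := integral_rpow_sub_rpow_div_log_Ioi
  have hnorm : ∀ u ∈ Set.Ioi (0 : ℝ), ∫ x in Set.Ioi (0 : ℝ), g u * Real.exp (-c u * x) =
      4 * ((u ^ (3 / 4 : ℝ) - u ^ (1 / 2 : ℝ)) / Real.log u / (1 + u + u ^ 2)) := by
    intro u hu
    have hu0 : 0 < u := hu
    rw [integral_const_mul, integral_exp_mul_Ioi (neg_neg_of_pos (hc0 hu0))]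
    have e3 : u ^ (3 / 4 : ℝ) = √u * u ^ (1 / 4 : ℝ) := by
      rw [sqrt_eq_rpow, ← rpow_add hu0]; norm_num
    have : 0 < √u := by positivity
    have hs : √u * √u = u := mul_self_sqrt hu0.le
    rw [e3, ← sqrt_eq_rpow, mul_zero, exp_zero]
    simp only [hg, hc]
    by_cases hl : Real.log u = 0
    · simp [hl]
    · field_simp
      rw [sq, hs]
  have hfi : Integrable (Function.uncurry fun x u : ℝ => -(g u * Real.exp (-c u * x)))
      ((volume.restrict (Set.Ioi 0)).prod (volume.restrict (Set.Ioi 0))) := by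
    rw [integrable_prod_iff' (Measurable.aestronglyMeasurable (by fun_prop))]
    refine ⟨?_, ?_⟩
    · filter_upwards [ae_restrict_mem measurableSet_Ioi] with u hu
      exact ((exp_neg_integrableOn_Ioi 0 (hc0 hu)).const_mul (g u)).neg
    · refine (hH.1.const_mul 4).congr ?_
      filter_upwards [ae_restrict_mem measurableSet_Ioi] with u hu
      rw [← hnorm u hu]
      refine integral_congr_ae (.of_forall fun x => ?_)
      simp only [Function.uncurry, norm_neg]
      exact (norm_of_nonneg (mul_nonneg (hg0 hu) (exp_pos _).le)).symm
  rw [integral_integral_swap hfi]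
  simp_rw [integral_neg]
  rw [setIntegral_congr_fun measurableSet_Ioi hnorm, integral_const_mul, hH.2]
  ring
end

section
/- The double integral ∫₀^∞ ∫₀^∞ exp(−(x² + xy + y²)/(4y)) · (y^{1/6} − x^{1/6}) / (x^{2/3} · √y · log(x/y)) dx dy equals log( sec⁴(π/9) / (4 (sin(π/36) + cos(π/36))⁴) ). -/
open Real MeasureTheory

/-- Fubini for nonnegative functions, with integrability checked on one of the iterated integrals. -/
lemma integral_swap_of_nonneg {f : ℝ → ℝ → ℝ} {S T : Set ℝ}
    (hS : MeasurableSet S) (hT : MeasurableSet T) (hm : Measurable (Function.uncurry f))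
    (h0 : ∀ x ∈ S, ∀ y ∈ T, 0 ≤ f x y)
    (hi : ∀ y ∈ T, IntegrableOn (fun x => f x y) S)
    (hg : IntegrableOn (fun y => ∫ x in S, f x y) T) :
    IntegrableOn (fun x => ∫ y in T, f x y) S ∧
      ∫ x in S, ∫ y in T, f x y = ∫ y in T, ∫ x in S, f x y := by
  have key : Integrable (Function.uncurry f) ((volume.restrict S).prod (volume.restrict T)) := by
    rw [integrable_prod_iff' hm.aestronglyMeasurable]
    refine ⟨(ae_restrict_iff' hT).2 (Filter.Eventually.of_forall hi), ?_⟩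
    refine IntegrableOn.congr_fun hg (fun y hy => ?_) hT
    refine setIntegral_congr_fun hS (fun x hx => ?_)
    exact (Real.norm_of_nonneg (h0 x hx y hy)).symm
  exact ⟨key.integral_prod_left, integral_integral_swap key⟩

lemma integral_rpow_div_one_add {a : ℝ} (h0 : 0 < a) (h1 : a < 1) :
    IntegrableOn (fun x : ℝ => x ^ (a - 1) / (1 + x)) (Set.Ioi 0) ∧
      ∫ x in Set.Ioi (0:ℝ), x ^ (a - 1) / (1 + x) = π / sin (π * a) := by
  have hx : ∀ x ∈ Set.Ioi (0:ℝ),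
      ∫ t in Set.Ioi (0:ℝ), x ^ (a - 1) * rexp (-((1 + x) * t)) = x ^ (a - 1) / (1 + x) := by
    intro x hx
    rw [Set.mem_Ioi] at hx
    have := integral_exp_mul_Ioi (a := -(1 + x)) (by linarith) 0
    simp only [neg_mul, mul_zero, Real.exp_zero, neg_div_neg_eq] at this
    rw [integral_const_mul, this, mul_one_div]
  have ht : ∀ t ∈ Set.Ioi (0:ℝ),
      ∫ x in Set.Ioi (0:ℝ), x ^ (a - 1) * rexp (-((1 + x) * t))
        = Gamma a * (rexp (-t) * t ^ ((1 - a) - 1)) := by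
    intro t ht
    rw [Set.mem_Ioi] at ht
    have := Real.integral_rpow_mul_exp_neg_mul_Ioi h0 ht
    calc _ = ∫ x in Set.Ioi (0:ℝ), rexp (-t) * (x ^ (a - 1) * rexp (-(t * x))) := by
          congr 1; ext x
          rw [show -((1 + x) * t) = -t + -(t * x) by ring, Real.exp_add]; ring
      _ = _ := by
          rw [integral_const_mul, this, show (1 - a) - 1 = -a by ring, Real.rpow_neg ht.le,
            one_div, Real.inv_rpow ht.le]
          ring
  have hG := Real.GammaIntegral_convergent (s := 1 - a) (by linarith)
  obtain ⟨hI, hE⟩ := integral_swap_of_nonneg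
    (f := fun x t => x ^ (a - 1) * rexp (-((1 + x) * t)))
    (measurableSet_Ioi (a := (0:ℝ))) (measurableSet_Ioi (a := (0:ℝ)))
    (by unfold Function.uncurry; fun_prop)
    (fun x hx y _ => mul_nonneg (Real.rpow_nonneg (le_of_lt hx) _) (Real.exp_nonneg _))
    (fun t ht => by
      have h := (integrableOn_rpow_mul_exp_neg_mul_rpow (p := 1) (s := a - 1) (b := t)
        (by linarith) one_pos ht).const_mul (rexp (-t))
      refine IntegrableOn.congr_fun h (fun x _ => ?_) measurableSet_Ioi
      simp only [Real.rpow_one]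
      rw [show -((1 + x) * t) = -t + -t * x by ring, Real.exp_add]; ring)
    (IntegrableOn.congr_fun (hG.const_mul (Gamma a)) (fun t h => (ht t h).symm)
      measurableSet_Ioi)
  refine ⟨IntegrableOn.congr_fun hI hx measurableSet_Ioi, ?_⟩
  rw [← setIntegral_congr_fun measurableSet_Ioi hx, hE,
    setIntegral_congr_fun measurableSet_Ioi ht, integral_const_mul,
    ← Real.Gamma_eq_integral (by linarith), Real.Gamma_mul_Gamma_one_sub]

lemma integral_rpow_div_one_sub_add_sq {s : ℝ} (h0 : -1 < s) (h1 : s < 1) :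
    IntegrableOn (fun v : ℝ => v ^ s / (1 - v + v ^ 2)) (Set.Ioi 0) ∧
      ∫ v in Set.Ioi (0:ℝ), v ^ s / (1 - v + v ^ 2)
        = π / 3 * (1 / sin (π * (1 + s) / 3) + 1 / sin (π * (1 - s) / 3)) := by
  obtain ⟨iA, eA⟩ := integral_rpow_div_one_add (a := (s + 1) / 3) (by linarith) (by linarith)
  obtain ⟨iB, eB⟩ := integral_rpow_div_one_add (a := (s + 2) / 3) (by linarith) (by linarith)
  set g : ℝ → ℝ := fun w =>
    1 / 3 * (w ^ ((s + 1) / 3 - 1) / (1 + w) + w ^ ((s + 2) / 3 - 1) / (1 + w)) with hg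
  have hgi : IntegrableOn g (Set.Ioi 0) := (iA.add iB).const_mul (1 / 3)
  have hge : ∫ w in Set.Ioi (0:ℝ), g w =
      1 / 3 * (π / sin (π * ((s + 1) / 3)) + π / sin (π * ((s + 2) / 3))) := by
    rw [hg, integral_const_mul, integral_add iA iB, eA, eB]
  have hv : ∀ v ∈ Set.Ioi (0:ℝ),
      (3 * v ^ ((3:ℝ) - 1)) • g (v ^ (3:ℝ)) = v ^ s / (1 - v + v ^ 2) := by
    intro v hv
    rw [Set.mem_Ioi] at hv
    have e1 : (v ^ (3:ℝ)) ^ ((s + 1) / 3 - 1) = v ^ s / v ^ 2 := by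
      rw [← Real.rpow_mul hv.le, ← Real.rpow_natCast v 2, ← Real.rpow_sub hv]
      congr 1; push_cast; ring
    have e2 : (v ^ (3:ℝ)) ^ ((s + 2) / 3 - 1) = v ^ s / v := by
      rw [← Real.rpow_mul hv.le, ← Real.rpow_sub_one hv.ne']
      congr 1; ring
    have e3 : v ^ ((3:ℝ) - 1) = v ^ 2 := by
      rw [← Real.rpow_natCast v 2]; norm_num
    have e4 : v ^ (3:ℝ) = v ^ 3 := by
      rw [← Real.rpow_natCast v 3]; norm_num
    simp only [hg, smul_eq_mul]
    rw [e1, e2, e3, e4]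
    have h2 : 1 - v + v ^ 2 ≠ 0 := by nlinarith [sq_nonneg (v - 1)]
    have h3 : 1 + v ^ 3 = (1 + v) * (1 - v + v ^ 2) := by ring
    have h4 : 1 + v ≠ 0 := by positivity
    rw [h3]
    field_simp
  constructor
  · have := (integrableOn_Ioi_comp_rpow_iff g (p := 3) (by norm_num)).2 hgi
    refine IntegrableOn.congr_fun this (fun v h => ?_) measurableSet_Ioi
    rw [← hv v h, abs_of_pos (by norm_num : (0:ℝ) < 3)]
  · rw [← setIntegral_congr_fun measurableSet_Ioi hv,
      integral_comp_rpow_Ioi_of_pos (g := g) (by norm_num : (0:ℝ) < 3), hge,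
      show π * ((s + 2) / 3) = π - π * (1 - s) / 3 by ring, Real.sin_pi_sub,
      show π * ((s + 1) / 3) = π * (1 + s) / 3 by ring]
    ring

lemma integrableOn_rpow_div_one_add_add_sq {s : ℝ} (h0 : -1 < s) (h1 : s < 1) :
    IntegrableOn (fun v : ℝ => v ^ s / (1 + v + v ^ 2)) (Set.Ioi 0) := by
  refine Integrable.mono' (integral_rpow_div_one_sub_add_sq h0 h1).1
    (Measurable.aestronglyMeasurable (by fun_prop))
    ((ae_restrict_iff' measurableSet_Ioi).2 (Filter.Eventually.of_forall fun v hv => ?_))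
  rw [Set.mem_Ioi] at hv
  rw [Real.norm_of_nonneg (by positivity)]
  have : 0 < 1 - v + v ^ 2 := by nlinarith [sq_nonneg (v - 1)]
  gcongr
  linarith

lemma integral_rpow_div_one_add_add_sq_add_half {s : ℝ} (h0 : -1 < s) (h1 : s < 1) :
    (∫ v in Set.Ioi (0:ℝ), v ^ s / (1 + v + v ^ 2))
      + (∫ v in Set.Ioi (0:ℝ), v ^ (s / 2) / (1 + v + v ^ 2))
      = π / 3 * (1 / sin (π * (1 + s) / 3) + 1 / sin (π * (1 - s) / 3)) := by
  have hv : ∀ v ∈ Set.Ioi (0:ℝ),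
      (2 * v ^ ((2:ℝ) - 1)) • ((v ^ (2:ℝ)) ^ (s / 2) / (1 + v ^ (2:ℝ) + (v ^ (2:ℝ)) ^ 2))
        = v ^ s / (1 - v + v ^ 2) - v ^ s / (1 + v + v ^ 2) := by
    intro v hv
    rw [Set.mem_Ioi] at hv
    have e1 : (v ^ (2:ℝ)) ^ (s / 2) = v ^ s := by
      rw [← Real.rpow_mul hv.le]; congr 1; ring
    have e2 : v ^ ((2:ℝ) - 1) = v := by norm_num
    rw [e1, e2, Real.rpow_two, smul_eq_mul]
    have h2 : 1 - v + v ^ 2 ≠ 0 := by nlinarith [sq_nonneg (v - 1)]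
    have h3 : 1 + v + v ^ 2 ≠ 0 := by positivity
    have h4 : 1 + v ^ 2 + (v ^ 2) ^ 2 = (1 - v + v ^ 2) * (1 + v + v ^ 2) := by ring
    rw [h4]
    field_simp
    ring
  obtain ⟨iN, eN⟩ := integral_rpow_div_one_sub_add_sq h0 h1
  rw [← integral_comp_rpow_Ioi_of_pos (g := fun v : ℝ => v ^ (s / 2) / (1 + v + v ^ 2))
      (by norm_num : (0:ℝ) < 2), setIntegral_congr_fun measurableSet_Ioi hv,
    integral_sub iN (integrableOn_rpow_div_one_add_add_sq h0 h1), eN]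
  ring

lemma cot_half_add {x y : ℝ} (hx0 : 0 < x) (hx1 : x < π) (hxy : x / 2 + y = π / 2) :
    cos x / sin x + cos y / sin y = 1 / sin x := by
  have hs : 0 < sin (x / 2) := sin_pos_of_pos_of_lt_pi (by linarith) (by linarith)
  have hc : 0 < cos (x / 2) := cos_pos_of_mem_Ioo ⟨by linarith, by linarith⟩
  have hy : y = π / 2 - x / 2 := by linarith
  have h1 : sin x = 2 * sin (x / 2) * cos (x / 2) := by rw [← sin_two_mul]; ring_nf
  have h2 : cos x = 1 - 2 * sin (x / 2) ^ 2 := by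
    rw [← cos_two_mul_eq_one_sub]; ring_nf
  rw [hy, cos_pi_div_two_sub, sin_pi_div_two_sub, h1, h2]
  field_simp
  ring

lemma integral_rpow_div_one_add_add_sq {s : ℝ} (h0 : 0 ≤ s) (h1 : s < 1) :
    ∫ v in Set.Ioi (0:ℝ), v ^ s / (1 + v + v ^ 2)
      = π / 3 * (cos (π * (1 + s) / 3) / sin (π * (1 + s) / 3)
          + cos (π * (1 - s) / 3) / sin (π * (1 - s) / 3)) := by
  set M : ℝ → ℝ := fun s => ∫ v in Set.Ioi (0:ℝ), v ^ s / (1 + v + v ^ 2) with hM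
  set C : ℝ → ℝ := fun s => π / 3 * (cos (π * (1 + s) / 3) / sin (π * (1 + s) / 3)
          + cos (π * (1 - s) / 3) / sin (π * (1 - s) / 3)) with hC
  have hpi := Real.pi_pos
  have hfun : ∀ t : ℝ, 0 ≤ t → t < 1 → M t - C t = -(M (t / 2) - C (t / 2)) := by
    intro t ht0 ht1
    have hm : M t + M (t / 2) = _ :=
      integral_rpow_div_one_add_add_sq_add_half (by linarith) ht1
    have c1 := cot_half_add (x := π * (1 + t) / 3) (y := π * (1 - t / 2) / 3)
      (by positivity) (by nlinarith) (by ring)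
    have c2 := cot_half_add (x := π * (1 - t) / 3) (y := π * (1 + t / 2) / 3)
      (by have : 0 < 1 - t := by linarith
          positivity) (by nlinarith) (by ring)
    rw [← c1, ← c2] at hm
    simp only [hC]
    linarith
  have habs : ∀ n : ℕ, |M s - C s| = |M (s / 2 ^ n) - C (s / 2 ^ n)| := by
    intro n
    induction n with
    | zero => simp
    | succ k ih =>
      have hle : s / 2 ^ k ≤ s := div_le_self h0 (one_le_pow₀ (by norm_num))
      rw [ih, hfun _ (by positivity) (by linarith), abs_neg, pow_succ, div_div]
  have hzero : M 0 - C 0 = 0 := by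
    have := hfun 0 le_rfl one_pos
    rw [zero_div] at this
    linarith
  have hlim : Filter.Tendsto (fun n : ℕ => s / 2 ^ n) Filter.atTop (nhds 0) :=
    tendsto_const_nhds.div_atTop (tendsto_pow_atTop_atTop_of_one_lt (by norm_num))
  have hCl : Filter.Tendsto (fun n : ℕ => C (s / 2 ^ n)) Filter.atTop (nhds (C 0)) := by
    have : ContinuousAt C 0 := by
      simp only [hC]
      fun_prop (disch := simp)
    exact this.tendsto.comp hlim
  have hMl : Filter.Tendsto (fun n : ℕ => M (s / 2 ^ n)) Filter.atTop (nhds (M 0)) := by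
    refine tendsto_integral_of_dominated_convergence
      ((fun v => v ^ (0:ℝ) / (1 + v + v ^ 2)) + fun v => v ^ s / (1 + v + v ^ 2))
      (fun n => Measurable.aestronglyMeasurable (by fun_prop))
      ((integrableOn_rpow_div_one_add_add_sq (by norm_num) one_pos).add
        (integrableOn_rpow_div_one_add_add_sq (by linarith) h1))
      (fun n => (ae_restrict_iff' measurableSet_Ioi).2
        (Filter.Eventually.of_forall fun v hv => ?_))
      ((ae_restrict_iff' measurableSet_Ioi).2 (Filter.Eventually.of_forall fun v hv => ?_))
    · rw [Set.mem_Ioi] at hv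
      rw [Real.norm_of_nonneg (by positivity), Pi.add_apply, ← add_div]
      gcongr
      have hle : s / 2 ^ n ≤ s := div_le_self h0 (one_le_pow₀ (by norm_num))
      rcases le_total v 1 with h | h
      · have := Real.rpow_le_rpow_of_exponent_ge hv h (by positivity : 0 ≤ s / 2 ^ n)
        have : 0 ≤ v ^ s := by positivity
        linarith
      · exact (Real.rpow_le_rpow_of_exponent_le h hle).trans
          (le_add_of_nonneg_left (by positivity))
    · rw [Set.mem_Ioi] at hv
      exact (((Real.continuous_const_rpow hv.ne').tendsto 0).comp hlim).div_const _
  have hD : Filter.Tendsto (fun n : ℕ => |M (s / 2 ^ n) - C (s / 2 ^ n)|) Filter.atTop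
      (nhds |M 0 - C 0|) := (hMl.sub hCl).abs
  simp only [← habs, hzero, abs_zero] at hD
  have := tendsto_nhds_unique hD tendsto_const_nhds
  exact sub_eq_zero.1 (abs_eq_zero.1 this.symm)

lemma hasDerivAt_log_sin_sub_log_sin {s : ℝ} (h0 : -1 < s) (h1 : s < 1) :
    HasDerivAt (fun s => log (sin (π * (1 + s) / 3)) - log (sin (π * (1 - s) / 3)))
      (π / 3 * (cos (π * (1 + s) / 3) / sin (π * (1 + s) / 3)
          + cos (π * (1 - s) / 3) / sin (π * (1 - s) / 3))) s := by
  have hpi := Real.pi_pos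
  have p1 : sin (π * (1 + s) / 3) ≠ 0 :=
    (sin_pos_of_pos_of_lt_pi (by have : 0 < 1 + s := by linarith
                                 positivity) (by nlinarith)).ne'
  have p2 : sin (π * (1 - s) / 3) ≠ 0 :=
    (sin_pos_of_pos_of_lt_pi (by have : 0 < 1 - s := by linarith
                                 positivity) (by nlinarith)).ne'
  have d1 : HasDerivAt (fun s : ℝ => π * (1 + s) / 3) (π * 1 / 3) s :=
    (((hasDerivAt_id s).const_add 1).const_mul π).div_const 3
  have d2 : HasDerivAt (fun s : ℝ => π * (1 - s) / 3) (π * (-1) / 3) s :=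
    (((hasDerivAt_id s).const_sub 1).const_mul π).div_const 3
  exact ((d1.sin.log p1).sub (d2.sin.log p2)).congr_deriv (by ring)

lemma integral_const_rpow_eq {v : ℝ} (hv : 0 < v) (hv1 : v ≠ 1) (a b : ℝ) :
    ∫ s in a..b, v ^ s = (v ^ b - v ^ a) / log v := by
  have hl : log v ≠ 0 := Real.log_ne_zero_of_pos_of_ne_one hv hv1
  have hd : ∀ s ∈ Set.uIcc a b, HasDerivAt (fun s => v ^ s / log v) (v ^ s) s := by
    intro s _
    exact ((Real.hasStrictDerivAt_const_rpow hv s).hasDerivAt.div_const (log v)).congr_deriv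
      (mul_div_cancel_right₀ _ hl)
  rw [intervalIntegral.integral_eq_sub_of_hasDerivAt hd
    ((Real.continuous_const_rpow hv.ne').intervalIntegrable _ _)]
  ring

lemma integral_integral_rpow_div_one_add_add_sq {a b : ℝ} (ha : 0 ≤ a) (hab : a ≤ b)
    (hb : b < 1) :
    IntegrableOn (fun v : ℝ => (v ^ b - v ^ a) / log v / (1 + v + v ^ 2)) (Set.Ioi 0) ∧
      ∫ v in Set.Ioi (0:ℝ), (v ^ b - v ^ a) / log v / (1 + v + v ^ 2)
        = (log (sin (π * (1 + b) / 3)) - log (sin (π * (1 - b) / 3)))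
          - (log (sin (π * (1 + a) / 3)) - log (sin (π * (1 - a) / 3))) := by
  have hpi := Real.pi_pos
  have hval : ∀ s ∈ Set.Ioc a b, _ := fun s hs =>
    integral_rpow_div_one_add_add_sq (s := s) (by linarith [hs.1]) (by linarith [hs.2])
  have hint : IntervalIntegrable (fun s => π / 3 * (cos (π * (1 + s) / 3) / sin (π * (1 + s) / 3)
          + cos (π * (1 - s) / 3) / sin (π * (1 - s) / 3))) volume a b := by
    refine ContinuousOn.intervalIntegrable fun s hs => ContinuousAt.continuousWithinAt ?_
    rw [Set.uIcc_of_le hab] at hs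
    have p1 : sin (π * (1 + s) / 3) ≠ 0 :=
      (sin_pos_of_pos_of_lt_pi (by have : 0 < 1 + s := by linarith [hs.1]
                                   positivity) (by nlinarith [hs.2])).ne'
    have p2 : sin (π * (1 - s) / 3) ≠ 0 :=
      (sin_pos_of_pos_of_lt_pi (by have : 0 < 1 - s := by linarith [hs.2]
                                   positivity) (by nlinarith [hs.1])).ne'
    fun_prop (disch := assumption)
  obtain ⟨hI, hE⟩ := integral_swap_of_nonneg
    (f := fun v s => v ^ s / (1 + v + v ^ 2))
    (measurableSet_Ioi (a := (0:ℝ))) (measurableSet_Ioc (a := a) (b := b))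
    (by unfold Function.uncurry; fun_prop)
    (fun v hv s _ => by rw [Set.mem_Ioi] at hv; positivity)
    (fun s hs => integrableOn_rpow_div_one_add_add_sq (by linarith [hs.1]) (by linarith [hs.2]))
    (IntegrableOn.congr_fun ((intervalIntegrable_iff_integrableOn_Ioc_of_le hab).1 hint)
      (fun s hs => (hval s hs).symm) measurableSet_Ioc)
  have hae : (fun v : ℝ => ∫ s in Set.Ioc a b, v ^ s / (1 + v + v ^ 2))
      =ᵐ[volume.restrict (Set.Ioi 0)]
      fun v => (v ^ b - v ^ a) / log v / (1 + v + v ^ 2) := by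
    rw [Filter.EventuallyEq, ae_restrict_iff' measurableSet_Ioi]
    filter_upwards [Measure.ae_ne volume (1:ℝ)] with v hv1 hv
    rw [integral_div, ← intervalIntegral.integral_of_le hab, integral_const_rpow_eq hv hv1]
  refine ⟨Integrable.congr hI hae, ?_⟩
  rw [← integral_congr_ae hae, hE, setIntegral_congr_fun measurableSet_Ioc hval,
    ← intervalIntegral.integral_of_le hab]
  refine intervalIntegral.integral_eq_sub_of_hasDerivAt
    (f := fun s => log (sin (π * (1 + s) / 3)) - log (sin (π * (1 - s) / 3)))
    (fun s hs => ?_) hint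
  rw [Set.uIcc_of_le hab] at hs
  exact hasDerivAt_log_sin_sub_log_sin (by linarith [hs.1]) (by linarith [hs.2])

lemma log_sin_pi_div_nine_identity :
    -4 * ((log (sin (π * (1 + 2 / 3) / 3)) - log (sin (π * (1 - 2 / 3) / 3)))
          - (log (sin (π * (1 + 1 / 2) / 3)) - log (sin (π * (1 - 1 / 2) / 3))))
      = log ((1 / cos (π / 9)) ^ 4 / (4 * (sin (π / 36) + cos (π / 36)) ^ 4)) := by
  have hpi := Real.pi_pos
  have e1 : sin (π * (1 + 2 / 3) / 3) = cos (π / 18) := by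
    rw [← sin_pi_div_two_sub, ← sin_pi_sub]; ring_nf
  have e2 : sin (π * (1 - 2 / 3) / 3) = 2 * sin (π / 18) * cos (π / 18) := by
    rw [← sin_two_mul]; ring_nf
  have e3 : sin (π * (1 + 1 / 2) / 3) = 1 := by
    rw [show π * (1 + 1 / 2) / 3 = π / 2 by ring, sin_pi_div_two]
  have e4 : sin (π * (1 - 1 / 2) / 3) = 1 / 2 := by
    rw [show π * (1 - 1 / 2) / 3 = π / 6 by ring, sin_pi_div_six]
  have e5 : cos (π / 9) = 1 - 2 * sin (π / 18) ^ 2 := by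
    rw [← cos_two_mul_eq_one_sub]; ring_nf
  have e6 : (sin (π / 36) + cos (π / 36)) ^ 2 = 1 + sin (π / 18) := by
    rw [show π / 18 = 2 * (π / 36) by ring, sin_two_mul]
    linear_combination sin_sq_add_cos_sq (π / 36)
  have e7 : 3 * sin (π / 18) - 4 * sin (π / 18) ^ 3 = 1 / 2 := by
    rw [← sin_three_mul, ← sin_pi_div_six]; ring_nf
  have hS : 0 < sin (π / 18) := sin_pos_of_pos_of_lt_pi (by linarith) (by linarith)
  have hC : 0 < cos (π / 18) := cos_pos_of_mem_Ioo ⟨by linarith, by linarith⟩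
  have hC9 : 0 < cos (π / 9) := cos_pos_of_mem_Ioo ⟨by linarith, by linarith⟩
  rw [e1, e2, e3, e4, show (sin (π / 36) + cos (π / 36)) ^ 4
    = ((sin (π / 36) + cos (π / 36)) ^ 2) ^ 2 by ring, e6, e5]
  rw [e5] at hC9
  set S := sin (π / 18)
  have key : 32 * S ^ 2 * (1 + S) * (1 - 2 * S ^ 2) ^ 2 = 1 := by
    have h : S * (1 - 2 * S ^ 2) = (1 - 2 * S) / 4 := by linear_combination e7 / 2
    calc _ = 32 * (1 + S) * (S * (1 - 2 * S ^ 2)) ^ 2 := by ring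
      _ = 1 := by rw [h]; linear_combination (-2) * e7
  have hrhs : (1 / (1 - 2 * S ^ 2)) ^ 4 / (4 * (1 + S) ^ 2) = (4 * S) ^ 4 := by
    rw [div_eq_iff (by positivity), div_pow, div_eq_iff (by positivity)]
    linear_combination (-(32 * S ^ 2 * (1 + S) * (1 - 2 * S ^ 2) ^ 2) - 1) * key
  rw [hrhs, log_pow, log_mul (by positivity) (by positivity), log_mul (by norm_num) hS.ne',
    log_mul (by norm_num) hS.ne', show (4:ℝ) = 2 ^ 2 by norm_num, log_pow, one_div, log_inv,
    log_one]
  push_cast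
  ring

lemma integrand_comp_mul {x v : ℝ} (hx : 0 < x) (hv : 0 < v) :
    x * (Real.exp (-(x^2 + x*(x*v) + (x*v)^2) / (4*(x*v))) *
        ((x*v) ^ ((1:ℝ)/6) - x ^ ((1:ℝ)/6)) /
        (x ^ ((2:ℝ)/3) * Real.sqrt (x*v) * Real.log (x/(x*v))))
      = -(rexp (-((1 + v + v ^ 2) / (4 * v)) * x)
          * ((v ^ ((2:ℝ)/3) - v ^ ((1:ℝ)/2)) / log v / v)) := by
  have h1 : -(x^2 + x*(x*v) + (x*v)^2) / (4*(x*v)) = -((1 + v + v ^ 2) / (4 * v)) * x := by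
    field_simp
  have h2 : log (x / (x * v)) = -log v := by
    rw [← Real.log_inv]; congr 1; field_simp
  have h3 : x ^ ((2:ℝ)/3) * x ^ ((1:ℝ)/2) = x * x ^ ((1:ℝ)/6) := by
    rw [← Real.rpow_add hx, ← Real.rpow_one_add' hx.le (by norm_num)]; norm_num
  have h4 : v ^ ((2:ℝ)/3) = v ^ ((1:ℝ)/2) * v ^ ((1:ℝ)/6) := by
    rw [← Real.rpow_add hv]; norm_num
  have h5 : v ^ ((1:ℝ)/2) * v ^ ((1:ℝ)/2) = v := by
    rw [← Real.rpow_add hv]; norm_num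
  rw [h1, h2, Real.mul_rpow hx.le hv.le, Real.sqrt_eq_rpow, Real.mul_rpow hx.le hv.le, h4,
    show x ^ ((2:ℝ)/3) * (x ^ ((1:ℝ)/2) * v ^ ((1:ℝ)/2)) * -log v
      = -(x * x ^ ((1:ℝ)/6) * v ^ ((1:ℝ)/2) * log v) by rw [← h3]; ring]
  have hq : 0 < x ^ ((1:ℝ)/6) := by positivity
  have hr : 0 < v ^ ((1:ℝ)/2) := by positivity
  set r := v ^ ((1:ℝ)/2)
  rcases eq_or_ne (log v) 0 with h | h
  · simp [h]
  rw [← h5]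
  field_simp

theorem stmt3 :
    (∫ x in Set.Ioi (0:ℝ), ∫ y in Set.Ioi (0:ℝ),
      Real.exp (-(x^2 + x*y + y^2) / (4*y)) *
        (y ^ ((1:ℝ)/6) - x ^ ((1:ℝ)/6)) /
        (x ^ ((2:ℝ)/3) * Real.sqrt y * Real.log (x/y)))
    = Real.log ((1 / Real.cos (π/9))^4 /
        (4 * (Real.sin (π/36) + Real.cos (π/36))^4)) := by
  set H : ℝ → ℝ := fun v => (v ^ ((2:ℝ)/3) - v ^ ((1:ℝ)/2)) / log v / v with hH
  have hH0 : ∀ v, 0 < v → 0 ≤ H v := by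
    intro v hv
    refine div_nonneg ?_ hv.le
    rcases le_total v 1 with h | h
    · refine div_nonneg_of_nonpos ?_ (Real.log_nonpos hv.le h)
      linarith [Real.rpow_le_rpow_of_exponent_ge hv h (by norm_num : (1:ℝ)/2 ≤ 2/3)]
    · refine div_nonneg ?_ (Real.log_nonneg h)
      linarith [Real.rpow_le_rpow_of_exponent_le h (by norm_num : (1:ℝ)/2 ≤ 2/3)]
  have hinner : ∀ x ∈ Set.Ioi (0:ℝ), (∫ y in Set.Ioi (0:ℝ),
      Real.exp (-(x^2 + x*y + y^2) / (4*y)) *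
        (y ^ ((1:ℝ)/6) - x ^ ((1:ℝ)/6)) /
        (x ^ ((2:ℝ)/3) * Real.sqrt y * Real.log (x/y)))
      = -∫ v in Set.Ioi (0:ℝ), rexp (-((1 + v + v ^ 2) / (4 * v)) * x) * H v := by
    intro x hx
    rw [Set.mem_Ioi] at hx
    have := integral_comp_mul_left_Ioi (fun y => Real.exp (-(x^2 + x*y + y^2) / (4*y)) *
        (y ^ ((1:ℝ)/6) - x ^ ((1:ℝ)/6)) /
        (x ^ ((2:ℝ)/3) * Real.sqrt y * Real.log (x/y))) 0 hx
    rw [mul_zero, smul_eq_mul, eq_inv_mul_iff_mul_eq₀ hx.ne'] at this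
    rw [← this, ← integral_const_mul, ← integral_neg]
    exact setIntegral_congr_fun measurableSet_Ioi fun v hv => integrand_comp_mul hx hv
  have houter : ∀ v ∈ Set.Ioi (0:ℝ),
      ∫ x in Set.Ioi (0:ℝ), rexp (-((1 + v + v ^ 2) / (4 * v)) * x) * H v
        = 4 * ((v ^ ((2:ℝ)/3) - v ^ ((1:ℝ)/2)) / log v / (1 + v + v ^ 2)) := by
    intro v hv
    rw [Set.mem_Ioi] at hv
    rw [integral_mul_const, integral_exp_mul_Ioi (neg_neg_of_pos (by positivity)), hH]
    simp only [mul_zero, Real.exp_zero]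
    have : 1 + v + v ^ 2 ≠ 0 := by positivity
    rcases eq_or_ne (log v) 0 with h | h
    · simp [h]
    field_simp
  obtain ⟨hI, hE⟩ := integral_integral_rpow_div_one_add_add_sq (a := 1 / 2) (b := 2 / 3)
    (by norm_num) (by norm_num) (by norm_num)
  obtain ⟨-, hsw⟩ := integral_swap_of_nonneg
    (f := fun x v => rexp (-((1 + v + v ^ 2) / (4 * v)) * x) * H v)
    (measurableSet_Ioi (a := (0:ℝ))) (measurableSet_Ioi (a := (0:ℝ)))
    (by unfold Function.uncurry; fun_prop)
    (fun x _ v hv => mul_nonneg (Real.exp_nonneg _) (hH0 v hv))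
    (fun v hv => by
      rw [Set.mem_Ioi] at hv
      exact (integrableOn_exp_mul_Ioi (neg_neg_of_pos (by positivity)) 0).mul_const _)
    (IntegrableOn.congr_fun (hI.const_mul 4) (fun v hv => (houter v hv).symm)
      measurableSet_Ioi)
  rw [setIntegral_congr_fun measurableSet_Ioi hinner, integral_neg, hsw,
    setIntegral_congr_fun measurableSet_Ioi houter, integral_const_mul, hE,
    ← log_sin_pi_div_nine_identity]
  ring
end

section
/- For a complex number m with −1 < Re(m) ≤ −1/2 and −1 < Im(m) < −1/2, and real p, q with p > √q > 0, the double integral ∫₀^∞ ∫₀^∞ x^m · y^{−m−1} · exp(−p x − q y − x²/(4y)) dx dy equals π · 2^{m+1} · q^{m/2} · csc(πm) · sinh(m · arccosh(p/√q)) / √(p² − q). -/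
open Real MeasureTheory Complex

/-- Integrating `g s * exp (-(t * h s))` first in `t` and then in `s`. -/
lemma integral_integral_mul_exp_neg_mul {g : ℝ → ℂ} {h : ℝ → ℝ} (hg : Measurable g)
    (hh : Measurable h) (hpos : ∀ s ∈ Set.Ioi (0 : ℝ), 0 < h s)
    (hint : IntegrableOn (fun s => g s / h s) (Set.Ioi 0)) :
    (∫ t in Set.Ioi (0 : ℝ), ∫ s in Set.Ioi (0 : ℝ), g s * Complex.exp (-(t * h s))) =
      ∫ s in Set.Ioi (0 : ℝ), g s / h s := by
  have hexp (s : ℝ) (hs : s ∈ Set.Ioi (0 : ℝ)) :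
      IntegrableOn (fun t : ℝ => g s * Complex.exp (-(t * h s))) (Set.Ioi 0) := by
    have h1 := (integrableOn_exp_mul_complex_Ioi (a := -(h s : ℂ)) (by simpa using hpos s hs) 0)
    refine IntegrableOn.congr_fun (h1.const_mul (g s)) (fun t _ => ?_) measurableSet_Ioi
    congr 2
    ring
  rw [integral_integral_swap]
  · refine setIntegral_congr_fun measurableSet_Ioi fun s hs => ?_
    have h1 := integral_exp_mul_complex_Ioi (a := -(h s : ℂ)) (by simpa using hpos s hs) 0
    simp only [integral_const_mul]
    have h2 : ∀ t : ℝ, -((t : ℂ) * h s) = -(h s : ℂ) * t := fun t => by ring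
    simp only [h2, h1]
    simp [div_eq_mul_inv]
  · have hmeas : Measurable (Function.uncurry fun t s : ℝ =>
        g s * Complex.exp (-(t * h s))) := by
      unfold Function.uncurry
      fun_prop
    rw [integrable_prod_iff' hmeas.aestronglyMeasurable]
    refine ⟨(ae_restrict_iff' measurableSet_Ioi).mpr (ae_of_all _ hexp), ?_⟩
    refine hint.norm.congr ((ae_restrict_iff' measurableSet_Ioi).mpr (ae_of_all _ fun s hs => ?_))
    have h1 := integral_exp_mul_Ioi (a := -(h s)) (by simpa using hpos s hs) 0
    have h2 : ∀ t : ℝ, ‖g s * Complex.exp (-(t * h s))‖ = ‖g s‖ * Real.exp (-(h s) * t) := by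
      intro t
      rw [norm_mul, Complex.norm_exp]
      congr 2
      simp
      ring
    simp only [Function.uncurry, h2, integral_const_mul, h1]
    simp [abs_of_pos (hpos s hs), div_eq_mul_inv]

lemma integrableOn_cpow_div_add {z : ℂ} {u : ℝ} (hz0 : 0 < z.re) (hz1 : z.re < 1) (hu : 0 < u) :
    IntegrableOn (fun s : ℝ => (s : ℂ) ^ (z - 1) / ((s + u : ℝ) : ℂ)) (Set.Ioi 0) := by
  have hmeas : Measurable fun s : ℝ => (s : ℂ) ^ (z - 1) / ((s + u : ℝ) : ℂ) := by fun_prop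
  have hnorm (s : ℝ) (hs : 0 < s) :
      ‖(s : ℂ) ^ (z - 1) / ((s + u : ℝ) : ℂ)‖ = s ^ (z.re - 1) / (s + u) := by
    rw [norm_div, norm_cpow_eq_rpow_re_of_pos hs, Complex.norm_real, Real.norm_eq_abs,
      abs_of_pos (by positivity)]
    simp
  rw [← Set.Ioc_union_Ioi_eq_Ioi zero_le_one]
  refine IntegrableOn.union ?_ ?_
  · have h1 : IntegrableOn (fun s : ℝ => s ^ (z.re - 1)) (Set.Ioc 0 1) := by
      rw [← intervalIntegrable_iff_integrableOn_Ioc_of_le zero_le_one]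
      exact intervalIntegral.intervalIntegrable_rpow' (by linarith)
    refine (h1.div_const u).mono' hmeas.aestronglyMeasurable
      ((ae_restrict_iff' measurableSet_Ioc).mpr (ae_of_all _ fun s hs => ?_))
    rw [hnorm s hs.1]
    have := hs.1
    gcongr
    linarith
  · have h1 : IntegrableOn (fun s : ℝ => s ^ (z.re - 2)) (Set.Ioi 1) :=
      integrableOn_Ioi_rpow_of_lt (by linarith) one_pos
    refine h1.mono' hmeas.aestronglyMeasurable
      ((ae_restrict_iff' measurableSet_Ioi).mpr (ae_of_all _ fun s hs => ?_))
    have hs0 : 0 < s := one_pos.trans hs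
    rw [hnorm s hs0, show z.re - 2 = z.re - 1 - 1 by ring, Real.rpow_sub_one hs0.ne' (z.re - 1)]
    gcongr
    linarith

/-- The Stieltjes transform of a power. -/
lemma integral_cpow_div_add {z : ℂ} {u : ℝ} (hz0 : 0 < z.re) (hz1 : z.re < 1) (hu : 0 < u) :
    ∫ s in Set.Ioi (0 : ℝ), (s : ℂ) ^ (z - 1) / ((s + u : ℝ) : ℂ) =
      (u : ℂ) ^ (z - 1) * (π / Complex.sin (π * z)) := by
  rw [← integral_integral_mul_exp_neg_mul (by fun_prop) (by fun_prop)
    (fun s (hs : 0 < s) => by positivity) (integrableOn_cpow_div_add hz0 hz1 hu)]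
  have hinner : Set.EqOn (fun t : ℝ => ∫ s in Set.Ioi (0 : ℝ),
      (s : ℂ) ^ (z - 1) * Complex.exp (-(t * ((s + u : ℝ) : ℂ))))
      (fun t : ℝ => Complex.Gamma z * ((t : ℂ) ^ ((1 - z) - 1) * Complex.exp (-(u * t))))
      (Set.Ioi 0) := by
    intro t ht
    have ht' : 0 < t := ht
    have h1 : ∀ s : ℝ, (s : ℂ) ^ (z - 1) * Complex.exp (-(t * ((s + u : ℝ) : ℂ))) =
        (s : ℂ) ^ (z - 1) * Complex.exp (-(t * s)) * Complex.exp (-(u * t)) := by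
      intro s
      rw [mul_assoc, ← Complex.exp_add]
      congr 2
      push_cast
      ring
    simp only [h1, integral_mul_const]
    rw [integral_cpow_mul_exp_neg_mul_Ioi hz0 ht', show (1 - z) - 1 = -z by ring, one_div,
      Complex.inv_cpow, Complex.cpow_neg]
    · ring
    · rw [Complex.arg_ofReal_of_nonneg ht'.le]; exact pi_pos.ne
  rw [setIntegral_congr_fun measurableSet_Ioi hinner, integral_const_mul,
    integral_cpow_mul_exp_neg_mul_Ioi (by simpa using hz1) hu, ← Complex.Gamma_mul_Gamma_one_sub,
    one_div, Complex.inv_cpow, ← Complex.cpow_neg, neg_sub]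
  · ring
  · rw [Complex.arg_ofReal_of_nonneg hu.le]; exact pi_pos.ne

/-- Rescaling the inner variable by `y = x * s / (2 * a)`. -/
lemma integral_cpow_mul_exp_rescale (m : ℂ) (p : ℝ) {a x : ℝ} (ha : 0 < a) (hx : 0 < x) :
    ∫ y in Set.Ioi (0 : ℝ), (x : ℂ) ^ m * (y : ℂ) ^ (-m - 1) *
        Complex.exp (-(p : ℂ) * x - (a ^ 2 : ℝ) * y - x ^ 2 / (4 * y)) =
      ((2 * a : ℝ) : ℂ) ^ m * ∫ s in Set.Ioi (0 : ℝ), (s : ℂ) ^ (-m - 1) *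
        Complex.exp (-(x * ((p + a * (s + s⁻¹) / 2 : ℝ) : ℂ))) := by
  have hb : 0 < x / (2 * a) := by positivity
  have h := integral_comp_mul_left_Ioi (fun y : ℝ => (x : ℂ) ^ m * (y : ℂ) ^ (-m - 1) *
        Complex.exp (-(p : ℂ) * x - (a ^ 2 : ℝ) * y - x ^ 2 / (4 * y))) 0 hb
  rw [mul_zero, eq_inv_smul_iff₀ hb.ne'] at h
  rw [← h, ← integral_smul, ← integral_const_mul]
  refine setIntegral_congr_fun measurableSet_Ioi fun s hs => ?_
  have hs' : 0 < s := hs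
  have hsC : (s : ℂ) ≠ 0 := by exact_mod_cast hs'.ne'
  have hxC : (x : ℂ) ≠ 0 := by exact_mod_cast hx.ne'
  have haC : (a : ℂ) ≠ 0 := by exact_mod_cast ha.ne'
  have hbC : ((x / (2 * a) : ℝ) : ℂ) ≠ 0 := by exact_mod_cast hb.ne'
  have hx2 : (x : ℂ) = ((2 * a : ℝ) : ℂ) * ((x / (2 * a) : ℝ) : ℂ) := by
    push_cast
    field_simp
  have hpow : ((x / (2 * a) : ℝ) : ℂ) * ((x : ℂ) ^ m * ((x / (2 * a) * s : ℝ) : ℂ) ^ (-m - 1)) =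
      ((2 * a : ℝ) : ℂ) ^ m * (s : ℂ) ^ (-m - 1) := by
    rw [Complex.ofReal_mul (x / (2 * a)) s, Complex.mul_cpow_ofReal_nonneg hb.le hs'.le,
      show (x : ℂ) ^ m = ((2 * a : ℝ) : ℂ) ^ m * ((x / (2 * a) : ℝ) : ℂ) ^ m by
        rw [← Complex.mul_cpow_ofReal_nonneg (by positivity) hb.le, ← hx2],
      Complex.cpow_sub _ _ hbC, Complex.cpow_neg, Complex.cpow_one]
    have : ((x / (2 * a) : ℝ) : ℂ) ^ m ≠ 0 := by
      rw [Ne, Complex.cpow_eq_zero_iff]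
      tauto
    field_simp
  rw [Complex.real_smul, ← mul_assoc, hpow, mul_assoc]
  congr 3
  push_cast
  field_simp
  ring

open Real MeasureTheory Complex

theorem stmt6 (m : ℂ) (hre1 : -1 < m.re) (hre2 : m.re ≤ -1/2)
    (him1 : -1 < m.im) (him2 : m.im < -1/2)
    (p q : ℝ) (hq : 0 < Real.sqrt q) (hp : Real.sqrt q < p) :
    (∫ x in Set.Ioi (0:ℝ), ∫ y in Set.Ioi (0:ℝ),
      (x:ℂ) ^ m * (y:ℂ) ^ (-m - 1) *
        Complex.exp (-(p:ℂ) * x - q * y - x^2 / (4*y)))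
    = (π : ℂ) * (2:ℂ) ^ (m + 1) * (q:ℂ) ^ (m/2) *
        (1 / Complex.sin (π * m)) *
        Complex.sinh (m * (Real.log (p / Real.sqrt q +
          Real.sqrt ((p / Real.sqrt q)^2 - 1)) : ℝ)) /
        (Real.sqrt (p^2 - q) : ℂ) := by
  set a := Real.sqrt q with ha
  have hq0 : 0 < q := Real.sqrt_pos.mp hq
  have hqa : q = a ^ 2 := (Real.sq_sqrt hq0.le).symm
  clear_value a
  subst hqa
  set c := p / a with hc
  have hpc : p = a * c := by rw [hc]; field_simp
  have hc1 : 1 < c := by rwa [hc, one_lt_div hq]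
  clear_value c
  subst hpc
  set d := Real.sqrt (c ^ 2 - 1) with hd
  have hd0 : 0 < d := Real.sqrt_pos.mpr (by nlinarith)
  have hd2 : d ^ 2 = c ^ 2 - 1 := Real.sq_sqrt (by nlinarith)
  clear_value d
  have hsqrt : Real.sqrt ((a * c) ^ 2 - a ^ 2) = a * d := by
    rw [show (a * c) ^ 2 - a ^ 2 = (a * d) ^ 2 by rw [mul_pow, mul_pow, hd2]; ring]
    exact Real.sqrt_sq (by positivity)
  have hu : 0 < c + d := by positivity
  have hv : 0 < c - d := by nlinarith
  have huv : c - d = (c + d)⁻¹ := by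
    refine eq_inv_of_mul_eq_one_left ?_
    linear_combination -hd2
  have hz0 : 0 < (-m).re := by simp; linarith
  have hz1 : (-m).re < 1 := by simp; linarith
  have haC : (a : ℂ) ≠ 0 := by exact_mod_cast hq.ne'
  have huC : ((c + d : ℝ) : ℂ) ≠ 0 := by exact_mod_cast hu.ne'
  have hvC : ((c - d : ℝ) : ℂ) ≠ 0 := by exact_mod_cast hv.ne'
  have hpf : Set.EqOn (fun s : ℝ => 1 / (a * d) *
        (((c + d : ℝ) : ℂ) * ((s : ℂ) ^ (-m - 1) / ((s + (c + d) : ℝ) : ℂ)) -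
        ((c - d : ℝ) : ℂ) * ((s : ℂ) ^ (-m - 1) / ((s + (c - d) : ℝ) : ℂ))))
      (fun s : ℝ => (s : ℂ) ^ (-m - 1) / ((a * c + a * (s + s⁻¹) / 2 : ℝ) : ℂ))
      (Set.Ioi 0) := by
    intro s hs
    have hs' : 0 < s := hs
    have h1 : s + (c + d) ≠ 0 := by positivity
    have h2 : s + (c - d) ≠ 0 := by positivity
    have h3 : a * c + a * (s + s⁻¹) / 2 ≠ 0 := by
      have : 0 < c := by linarith
      positivity
    have key : 1 / (a * d) * ((c + d) / (s + (c + d)) - (c - d) / (s + (c - d))) =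
        1 / (a * c + a * (s + s⁻¹) / 2) := by
      have h4 : (s + (c + d)) * (s + (c - d)) = s ^ 2 + 2 * c * s + 1 := by
        linear_combination -hd2
      have h5 : a * c + a * (s + s⁻¹) / 2 = a * ((s + (c + d)) * (s + (c - d))) / (2 * s) := by
        rw [h4]
        field_simp
        ring
      rw [h5]
      field_simp
      ring
    have keyC := congrArg (fun r : ℝ => (s : ℂ) ^ (-m - 1) * (r : ℂ)) key
    simp only [Complex.ofReal_mul (1 / (a * d)), Complex.ofReal_sub (_ / _), Complex.ofReal_div _ (_ + _)] at keyC
    push_cast at keyC ⊢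
    simp only [div_eq_mul_inv] at keyC ⊢
    linear_combination keyC
  have hiu := (integrableOn_cpow_div_add hz0 hz1 hu).const_mul ((c + d : ℝ) : ℂ)
  have hiv := (integrableOn_cpow_div_add hz0 hz1 hv).const_mul ((c - d : ℝ) : ℂ)
  rw [setIntegral_congr_fun measurableSet_Ioi
    (fun x hx => integral_cpow_mul_exp_rescale m (a * c) hq hx), integral_const_mul,
    integral_integral_mul_exp_neg_mul (by fun_prop) (by fun_prop)
      (fun s (hs : 0 < s) => by
        have : 0 < c := by linarith
        positivity)
      (IntegrableOn.congr_fun ((hiu.sub hiv).const_mul _) hpf measurableSet_Ioi),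
    ← setIntegral_congr_fun measurableSet_Ioi hpf, integral_const_mul, integral_sub hiu hiv,
    integral_const_mul, integral_const_mul, integral_cpow_div_add hz0 hz1 hu,
    integral_cpow_div_add hz0 hz1 hv, hsqrt]
  have hpu : ((c + d : ℝ) : ℂ) * ((c + d : ℝ) : ℂ) ^ (-m - 1) =
      Complex.exp (-(m * (Real.log (c + d) : ℝ))) := by
    rw [Complex.cpow_sub _ _ huC, Complex.cpow_one, mul_div_cancel₀ _ huC,
      Complex.cpow_def_of_ne_zero huC, ← Complex.ofReal_log hu.le]
    congr 1
    ring
  have hpv : ((c - d : ℝ) : ℂ) * ((c - d : ℝ) : ℂ) ^ (-m - 1) =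
      Complex.exp (m * (Real.log (c + d) : ℝ)) := by
    rw [Complex.cpow_sub _ _ hvC, Complex.cpow_one, mul_div_cancel₀ _ hvC,
      Complex.cpow_def_of_ne_zero hvC, ← Complex.ofReal_log hv.le, huv, Real.log_inv]
    congr 1
    push_cast
    ring
  have hqm : ((a ^ 2 : ℝ) : ℂ) ^ (m / 2) = (a : ℂ) ^ m := by
    have h2 : ((a ^ 2 : ℝ) : ℂ) ≠ 0 := by exact_mod_cast hq0.ne'
    rw [Complex.cpow_def_of_ne_zero h2, Complex.cpow_def_of_ne_zero haC,
      ← Complex.ofReal_log hq0.le, ← Complex.ofReal_log hq.le, Real.log_pow]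
    congr 1
    push_cast
    ring
  have h2a : ((2 * a : ℝ) : ℂ) ^ m = 2 ^ m * (a : ℂ) ^ m := by
    rw [Complex.ofReal_mul, Complex.mul_cpow_ofReal_nonneg zero_le_two hq.le, Complex.ofReal_ofNat]
  rw [← mul_assoc ((c + d : ℝ) : ℂ), ← mul_assoc ((c - d : ℝ) : ℂ), hpu, hpv, hqm, h2a,
    Complex.cpow_add _ _ two_ne_zero, Complex.cpow_one, mul_neg, Complex.sin_neg, Complex.sinh,
    Complex.ofReal_mul a d, div_neg]
  simp only [div_eq_mul_inv, mul_inv]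
  ring
end
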